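/- For all sufficiently large n, every n-edge-coloured multigraph in which each colour class is a matching of size at least n contains a rainbow matching of size at least n - 20 n^{7/8}. -/

import Mathlib

open Finset
open scoped Classical

section Defs

variable {V C E : Type*}

/-- The two endpoints of an edge of a multigraph given by endpoint functions `e₁ e₂`. -/
def edgeEnds [DecidableEq V] (e₁ e₂ : E → V) (e : E) : Finset V := {e₁ e, e₂ e}

/-- A finite set of edges is a matching: all edges are non-loops and pairwise vertex-disjoint. -/
def IsMatchingE [DecidableEq V] (e₁ e₂ : E → V) (M : Finset E) : Prop :=
  (∀ e ∈ M, e₁ e ≠ e₂ e) ∧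
  ∀ a ∈ M, ∀ b ∈ M, a ≠ b → Disjoint (edgeEnds e₁ e₂ a) (edgeEnds e₁ e₂ b)

/-- A set of edges is rainbow: all its edges have pairwise distinct colours. -/
def IsRainbow (col : E → C) (M : Finset E) : Prop := Set.InjOn col ↑M

/-- The colour class of colour `c`: the set of all edges of colour `c`. -/
noncomputable def colourClass [Fintype E] (col : E → C) (c : C) : Finset E :=
  Finset.univ.filter fun e => col e = c

/-- The set of vertices covered by a set of edges `M`. -/
def matchedVerts [DecidableEq V] (e₁ e₂ : E → V) (M : Finset E) : Finset V :=
  M.biUnion (edgeEnds e₁ e₂)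

/-- The set of vertices spanned by the colour class of `c`
(i.e. incident to at least one edge of colour `c`). -/
noncomputable def spannedVerts [Fintype V] [DecidableEq V] [Fintype E]
    (e₁ e₂ : E → V) (col : E → C) (c : C) : Finset V :=
  Finset.univ.filter fun v => ∃ e, col e = c ∧ (e₁ e = v ∨ e₂ e = v)

/-- `u` and `v` are distinct vertices joined by an edge of colour `c`. -/
def adjOfColour (e₁ e₂ : E → V) (col : E → C) (c : C) (u v : V) : Prop :=
  u ≠ v ∧ ∃ e, col e = c ∧ ((e₁ e = u ∧ e₂ e = v) ∨ (e₁ e = v ∧ e₂ e = u))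

/-- The colour class of `c` is a vertex-disjoint union of (non-trivial) cliques:
whenever `uv` and `vw` are edges of colour `c` with `u ≠ w`, also `uw` is an
edge of colour `c`. -/
def IsCliqueUnion (e₁ e₂ : E → V) (col : E → C) (c : C) : Prop :=
  ∀ u v w, adjOfColour e₁ e₂ col c u v → adjOfColour e₁ e₂ col c v w → u ≠ w →
    adjOfColour e₁ e₂ col c u w

end Defs


set_option linter.all false

section TB
variable {V : Type*} [Fintype V] [DecidableEq V]

/-- Support of a function. -/
noncomputable def spt (q : V → V) : Finset V := univ.filter fun v => q v ≠ v

/-- `q` is (the involution of) a matching of the relation `G` inside `W`. -/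
def GMat (G : V → V → Prop) (W : Finset V) (q : V → V) : Prop :=
  (∀ v, q (q v) = v) ∧ ∀ v, q v ≠ v → v ∈ W ∧ G v (q v)

lemma mem_spt (q : V → V) (v : V) : v ∈ spt q ↔ q v ≠ v := by simp [spt]

lemma even_of_invol (q : V → V) (hq : ∀ v, q (q v) = v) (Y : Finset V)
    (hY : ∀ v ∈ Y, q v ∈ Y ∧ q v ≠ v) : Even Y.card := by
  have h : (∑ v ∈ Y, (1 : ZMod 2)) = 0 := by
    apply Finset.sum_involution (fun v _ => q v)
    · intro a _; decide
    · intro a ha _; exact (hY a ha).2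
    · intro a ha; exact (hY a ha).1
    · intro a _; exact hq a
  simp at h
  exact (ZMod.natCast_eq_zero_iff_even).1 h

lemma even_spt (q : V → V) (hq : ∀ v, q (q v) = v) : Even (spt q).card := by
  apply even_of_invol q hq
  intro v hv
  rw [mem_spt] at *
  exact ⟨by rw [hq]; exact hv.symm, hv⟩

lemma GMat_add (G : V → V → Prop) (hs : ∀ v w, G v w → G w v) (W : Finset V) (q : V → V)
    (hq : GMat G W q) (x y : V) (hx : x ∈ W) (hy : y ∈ W) (hxy : x ≠ y) (hG : G x y)
    (hqx : q x = x) (hqy : q y = y) :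
    ∃ q', GMat G W q' ∧ (spt q).card < (spt q').card := by
  obtain ⟨h1, h2⟩ := hq
  refine ⟨fun w => if w = x then y else if w = y then x else q w, ⟨?_, ?_⟩, ?_⟩
  · intro v
    have : ∀ w, q w = x → w = x := fun w h => by rw [← h1 w, h, hqx]
    have : ∀ w, q w = y → w = y := fun w h => by rw [← h1 w, h, hqy]
    grind
  · intro v
    grind
  · apply Finset.card_lt_card
    rw [Finset.ssubset_iff_of_subset]
    · exact ⟨x, by simp [mem_spt, hxy.symm], by simp [mem_spt, hqx]⟩
    · intro w; simp only [mem_spt]; grind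

lemma GMat_swap (G : V → V → Prop) (hs : ∀ v w, G v w → G w v) (W : Finset V) (q : V → V)
    (hq : GMat G W q) (x y : V) (hx : x ∈ W) (hxy : x ≠ y) (hG : G x y)
    (hqx : q x = x) (hqy : q y ≠ y) :
    ∃ q', GMat G W q' ∧ (spt q').card = (spt q).card ∧ q' x = y ∧ q' (q y) = q y ∧
      ∀ w, w ≠ x → w ≠ y → w ≠ q y → q' w = q w := by
  obtain ⟨h1, h2⟩ := hq
  have a1 : ∀ w, q w = x → w = x := fun w h => by rw [← h1 w, h, hqx]
  have a2 : ∀ w, q w = q y → w = y := fun w h => by rw [← h1 w, h, h1]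
  have a3 : q y ≠ x := fun h => hxy (a1 y h).symm
  have a4 := h1 y
  refine ⟨fun w => if w = x then y else if w = y then x else if w = q y then q y else q w,
    ⟨?_, ?_⟩, ?_, ?_, ?_, ?_⟩
  · intro v
    have := h1 v
    have := a1 v
    have := a2 v
    have : q v = y → v = q y := fun h => by rw [← h, h1]
    grind
  · intro v
    have := h2 v
    have := h2 y
    have := hs x y hG
    grind
  · have : spt (fun w => if w = x then y else if w = y then x else if w = q y then q y else q w)
      = insert x ((spt q).erase (q y)) := by
      ext w
      simp only [mem_spt, mem_insert, mem_erase]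
      grind
    rw [this, card_insert_of_notMem (by simp [mem_spt, hqx]), card_erase_of_mem]
    · have : 0 < (spt q).card := card_pos.2 ⟨y, by simpa [mem_spt] using hqy⟩
      omega
    · simp only [mem_spt]; rw [h1]; exact hqy.symm
  · simp
  · grind
  · grind

/-- Transitivity in Gallai's lemma. -/
lemma gallai_trans (G : V → V → Prop) (hs : ∀ v w, G v w → G w v) (W : Finset V) (ν : ℕ)
    (hmax : ∀ q, GMat G W q → (spt q).card ≤ ν)
    (t u v : V) (huv : u ≠ v)
    (ht : ∃ q, GMat G W q ∧ (spt q).card = ν ∧ q t = t)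
    (hut : ∀ q, GMat G W q → (spt q).card = ν → ¬ (q u = u ∧ q t = t))
    (htv : ∀ q, GMat G W q → (spt q).card = ν → ¬ (q t = t ∧ q v = v)) :
    ∀ q, GMat G W q → (spt q).card = ν → ¬ (q u = u ∧ q v = v) := by
  rintro q hq hqν ⟨hu, hv⟩
  let ag : (V → V) → ℕ := fun q' => (univ.filter fun w => q w = q' w ∧ q w ≠ w).card
  obtain ⟨q', hq'm, hq'max⟩ := Finset.exists_max_image
    (univ.filter fun q' : V → V => GMat G W q' ∧ (spt q').card = ν ∧ q' t = t) ag
    (by obtain ⟨a, ha⟩ := ht; exact ⟨a, by simpa using ha⟩)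
  simp only [mem_filter, mem_univ, true_and] at hq'm hq'max
  obtain ⟨hq', hq'ν, hq't⟩ := hq'm
  have hu' : q' u ≠ u := fun h => hut q' hq' hq'ν ⟨h, hq't⟩
  have hv' : q' v ≠ v := fun h => htv q' hq' hq'ν ⟨hq't, h⟩
  have hqt : q t ≠ t := fun h => hut q hq hqν ⟨hu, h⟩
  have hc : (spt q \ spt q').card = (spt q' \ spt q).card := by
    have := card_sdiff_add_card_inter (spt q) (spt q')
    have h2 := card_sdiff_add_card_inter (spt q') (spt q)
    rw [inter_comm] at h2
    omega
  have h2 : 2 ≤ (spt q' \ spt q).card := by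
    rw [← card_pair huv]
    apply card_le_card
    intro w hw
    simp only [mem_insert, mem_singleton] at hw
    simp only [mem_sdiff, mem_spt]
    rcases hw with rfl | rfl <;> simp [*]
  obtain ⟨x, hx, hxt⟩ := Finset.exists_mem_ne (s := spt q \ spt q') (by omega) t
  simp only [mem_sdiff, mem_spt, not_not] at hx
  obtain ⟨hqx, hq'x⟩ := hx
  have hxW := (hq.2 x hqx).1
  have hGx := (hq.2 x hqx).2
  have hyW : q x ∈ W := (hq.2 (q x) (by rw [hq.1]; exact hqx.symm)).1
  have hq'y : q' (q x) ≠ q x := by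
    intro h
    obtain ⟨q2, h1, h2⟩ := GMat_add G hs W q' hq' x (q x) hxW hyW hqx.symm hGx hq'x h
    have := hmax q2 h1
    omega
  obtain ⟨q2, hq2, hq2c, e1, e2, e3⟩ := GMat_swap G hs W q' hq' x (q x) hxW hqx.symm hGx hq'x hq'y
  have hzx : q' (q x) ≠ x := by
    intro h
    have := hq'.1 (q x)
    rw [h, hq'x] at this
    exact hqx this.symm
  have htq : q2 t = t := by
    by_cases h : t = q x
    · exact absurd (h ▸ hq't) hq'y
    by_cases h' : t = q' (q x)
    · rw [h']; exact e2
    rw [e3 t hxt.symm h h', hq't]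
  have := hq'max q2 ⟨hq2, by omega, htq⟩
  have hlt : ag q' < ag q2 := by
    apply Finset.card_lt_card
    rw [Finset.ssubset_iff_of_subset]
    · exact ⟨x, by simp [e1, hqx], by simp [hq'x, hqx]⟩
    · intro w
      simp only [mem_filter, mem_univ, true_and]
      rintro ⟨h1, h2⟩
      refine ⟨?_, h2⟩
      rw [e3 w, h1]
      · rintro rfl; exact h2 (h1.trans hq'x)
      · rintro rfl
        rw [hq.1] at h1
        exact hzx h1.symm
      · rintro rfl
        rw [hq'.1] at h1
        have := hq.1 (q' (q x))
        rw [h1, hq.1] at this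
        exact hzx this.symm
  omega

theorem tutte_berge (G : V → V → Prop) (hs : ∀ v w, G v w → G w v) : ∀ (W : Finset V),
    ∃ U ⊆ W, ∃ ρ : V → V,
      (∀ v ∈ W \ U, ∀ w ∈ W \ U, v ≠ w → G v w → ρ v = ρ w) ∧
      (∀ v ∈ W \ U, ∃ q, GMat G (W \ U) q ∧
        spt q = ((W \ U).filter fun w => ρ w = ρ v).erase v) ∧
      ∃ q, GMat G W q ∧ W.card + U.card ≤ (spt q).card + ((W \ U).image ρ).card := by
  intro W
  induction W using Finset.strongInduction with
  | H W ih =>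
  have hid : GMat G W id := ⟨fun _ => rfl, fun v h => absurd rfl h⟩
  obtain ⟨q0, hq0, hq0max⟩ := Finset.exists_max_image
    (univ.filter fun q' : V → V => GMat G W q') (fun q => (spt q).card)
    ⟨id, by simpa using hid⟩
  simp only [mem_filter, mem_univ, true_and] at hq0 hq0max
  by_cases hess : ∃ v ∈ W, ∀ q, GMat G (W.erase v) q → (spt q).card < (spt q0).card
  · obtain ⟨v, hvW, hv⟩ := hess
    obtain ⟨U, hU, ρ, h1, h2, q, hq, hcard⟩ := ih (W.erase v) (erase_ssubset hvW)
    have hvU : v ∉ U := fun h => by simpa using hU h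
    have hWU : W \ insert v U = W.erase v \ U := by
      ext w; simp only [mem_sdiff, mem_insert, mem_erase]; tauto
    refine ⟨insert v U, ?_, ρ, ?_, ?_, q0, hq0, ?_⟩
    · exact insert_subset hvW (hU.trans (erase_subset _ _))
    · rw [hWU]; exact h1
    · rw [hWU]; exact h2
    · rw [hWU, card_insert_of_notMem hvU]
      have := hv q hq
      have e1 := even_spt q hq.1
      have e2 := even_spt q0 hq0.1
      rw [card_erase_of_mem hvW] at hcard
      have : 0 < W.card := card_pos.2 ⟨v, hvW⟩
      obtain ⟨a, ha⟩ := e1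
      obtain ⟨b, hb⟩ := e2
      omega
  · push Not at hess
    set ν := (spt q0).card with hν
    have hin : ∀ v ∈ W, ∃ q, GMat G W q ∧ (spt q).card = ν ∧ q v = v := by
      intro v hv
      obtain ⟨q, hq, hc⟩ := hess v hv
      have hq' : GMat G W q := ⟨hq.1, fun w hw => ⟨mem_of_mem_erase (hq.2 w hw).1, (hq.2 w hw).2⟩⟩
      refine ⟨q, hq', le_antisymm (hq0max q hq') hc, ?_⟩
      by_contra h
      simpa using (hq.2 v h).1
    let r : Setoid V :=
      { r := fun u v => u = v ∨ (u ∈ W ∧ v ∈ W ∧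
          ∀ q, GMat G W q → (spt q).card = ν → ¬ (q u = u ∧ q v = v))
        iseqv := by
          refine ⟨fun x => Or.inl rfl, ?_, ?_⟩
          · rintro x y (h | ⟨h1, h2, h3⟩)
            · exact Or.inl h.symm
            · exact Or.inr ⟨h2, h1, fun q a b c => h3 q a b c.symm⟩
          · rintro x y z (rfl | ⟨h1, h2, h3⟩)
            · exact id
            rintro (rfl | ⟨h4, h5, h6⟩)
            · exact Or.inr ⟨h1, h2, h3⟩
            by_cases hxz : x = z
            · exact Or.inl hxz
            exact Or.inr ⟨h1, h5, gallai_trans G hs W ν hq0max y x z hxz (hin y h2) h3 h6⟩ }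
    let ρ : V → V := fun v => (Quotient.mk r v).out
    have hρ : ∀ v w, ρ v = ρ w ↔ (v = w ∨ (v ∈ W ∧ w ∈ W ∧
          ∀ q, GMat G W q → (spt q).card = ν → ¬ (q v = v ∧ q w = w))) := by
      intro v w
      rw [show (ρ v = ρ w ↔ _) from Quotient.out_inj, Quotient.eq]
      rfl
    have hadj : ∀ v ∈ W, ∀ w ∈ W, v ≠ w → G v w → ρ v = ρ w := by
      intro v hv w hw hvw hG
      rw [hρ]
      refine Or.inr ⟨hv, hw, ?_⟩
      rintro q hq hqν ⟨h1, h2⟩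
      obtain ⟨q2, h3, h4⟩ := GMat_add G hs W q hq v w hv hw hvw hG h1 h2
      have := hq0max q2 h3
      omega
    refine ⟨∅, empty_subset _, ρ, by simpa using hadj, ?_, q0, hq0, ?_⟩
    · simp only [sdiff_empty]
      intro v hv
      obtain ⟨q, hq, hqν, hqv⟩ := hin v hv
      have hqρ : ∀ w, q w ≠ w → ρ (q w) = ρ w := by
        intro w hw
        have h1 := hq.2 w hw
        have h2 := hq.2 (q w) (by rw [hq.1]; exact hw.symm)
        exact (hadj w h1.1 _ h2.1 hw.symm h1.2).symm
      refine ⟨fun w => if ρ w = ρ v then q w else w, ⟨?_, ?_⟩, ?_⟩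
      · intro w
        have := hqρ w
        have := hq.1 w
        grind
      · intro w
        have := hq.2 w
        grind
      · ext w
        simp only [mem_spt, mem_erase, mem_filter]
        constructor
        · intro h
          have := hq.2 w
          grind
        · rintro ⟨h1, h2, h3⟩
          rw [if_pos h3]
          intro h
          rcases (hρ w v).1 h3 with h4 | ⟨_, _, h4⟩
          · exact h1 h4
          · exact h4 q hq hqν ⟨h, hqv⟩
    · simp only [sdiff_empty, card_empty, add_zero]
      have hsub : spt q0 ⊆ W := fun w hw => (hq0.2 w ((mem_spt _ _).1 hw)).1
      have : (W \ spt q0).card ≤ (W.image ρ).card := by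
        apply card_le_card_of_injOn ρ
        · intro w hw
          exact mem_image_of_mem _ (mem_sdiff.1 hw).1
        · intro v hv w hw hvw
          simp only [coe_sdiff, Set.mem_diff, mem_coe, mem_spt, not_not] at hv hw
          rcases (hρ v w).1 hvw with h | ⟨_, _, h⟩
          · exact h
          · exact absurd ⟨hv.2, hw.2⟩ (h q0 hq0 rfl)
      rw [card_sdiff_of_subset hsub] at this
      omega
end TB


section Aug
variable {V K : Type*} [Fintype V] [DecidableEq V] [DecidableEq K]

/-- vertices of a coloured edge set -/
def vs (p : K → V → V) (N : Finset (K × V)) : Finset V := N.biUnion fun a => {a.2, p a.1 a.2}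

/-- rainbow matching -/
def Rb (p : K → V → V) (N : Finset (K × V)) : Prop :=
  (∀ a ∈ N, p a.1 a.2 ≠ a.2) ∧ ∀ a ∈ N, ∀ b ∈ N, a ≠ b →
    a.1 ≠ b.1 ∧ Disjoint ({a.2, p a.1 a.2} : Finset V) {b.2, p b.1 b.2}

def cols (N : Finset (K × V)) : Finset K := N.image Prod.fst

def Clo (mt : V → V) (Y : Finset V) : Prop := ∀ v ∈ Y, mt v ∈ Y

def cov (mt : V → V) (Y : Finset V) : ℕ := (Y.filter fun v => mt v ≠ v).card

def NoAug (mt : V → V) (p : K → V → V) : Prop :=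
  ∀ Y N, Clo mt Y → Rb p N → vs p N ⊆ Y → 2 * N.card ≤ cov mt Y

def Fr (mt : V → V) (p : K → V → V) (v : V) (Y : Finset V) (N : Finset (K × V)) : Prop :=
  Clo mt Y ∧ Rb p N ∧ v ∈ Y ∧ vs p N ⊆ Y.erase v ∧ 2 * N.card = cov mt Y

def Free (mt : V → V) (p : K → V → V) (v : V) (Z : Finset V) (Γ : Finset K) (b : ℕ) : Prop :=
  ∃ Y N, Fr mt p v Y N ∧ Disjoint Y Z ∧ Y.card ≤ b ∧ Disjoint (cols N) Γ

def InF (mt : V → V) (p : K → V → V) (r b : ℕ) (v : V) : Prop :=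
  ∀ Z Γ, Clo mt Z → v ∉ Z → Z.card ≤ r → Γ.card ≤ r → Free mt p v Z Γ b

lemma Clo_union {mt : V → V} {Y Z : Finset V} (h : Clo mt Y) (h' : Clo mt Z) : Clo mt (Y ∪ Z) := by
  intro v hv
  rcases mem_union.1 hv with h1 | h1
  · exact mem_union_left _ (h v h1)
  · exact mem_union_right _ (h' v h1)

lemma Clo_sdiff {mt : V → V} (hm : ∀ v, mt (mt v) = v) {Y Z : Finset V} (h : Clo mt Y)
    (h' : Clo mt Z) : Clo mt (Y \ Z) := by
  intro v hv
  rw [mem_sdiff] at hv ⊢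
  refine ⟨h v hv.1, fun h2 => hv.2 ?_⟩
  have := h' _ h2
  rwa [hm] at this

lemma Clo_pair {mt : V → V} (hm : ∀ v, mt (mt v) = v) (x : V) : Clo mt {x, mt x} := by
  intro v hv
  simp only [mem_insert, mem_singleton] at hv ⊢
  rcases hv with rfl | rfl
  · exact Or.inr rfl
  · exact Or.inl (hm _)

lemma cov_union {mt : V → V} {Y Z : Finset V} (h : Disjoint Y Z) :
    cov mt (Y ∪ Z) = cov mt Y + cov mt Z := by
  unfold cov
  rw [filter_union, card_union_of_disjoint (disjoint_filter_filter h)]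

lemma cov_pair {mt : V → V} (hm : ∀ v, mt (mt v) = v) {x : V} (hx : mt x ≠ x) :
    cov mt {x, mt x} = 2 := by
  unfold cov
  rw [filter_true_of_mem, card_pair hx.symm]
  intro v hv
  simp only [mem_insert, mem_singleton] at hv
  rcases hv with rfl | rfl
  · exact hx
  · rw [hm]; exact hx.symm

lemma cov_le {mt : V → V} (Y : Finset V) : cov mt Y ≤ Y.card := card_filter_le _ _

lemma vs_union (p : K → V → V) (N N' : Finset (K × V)) : vs p (N ∪ N') = vs p N ∪ vs p N' := by
  unfold vs; rw [union_biUnion]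

lemma vs_single (p : K → V → V) (c : K) (v : V) : vs p {(c, v)} = {v, p c v} := by
  simp [vs]

lemma Rb_single (p : K → V → V) (c : K) (v : V) (h : p c v ≠ v) : Rb p {(c, v)} := by
  refine ⟨by simpa using h, ?_⟩
  intro a ha b hb hab
  rw [mem_singleton] at ha hb
  exact absurd (ha.trans hb.symm) hab

lemma mem_cols {N : Finset (K × V)} {a : K × V} (h : a ∈ N) : a.1 ∈ cols N :=
  mem_image_of_mem _ h

lemma sub_vs (p : K → V → V) {N : Finset (K × V)} {a : K × V} (h : a ∈ N) :
    ({a.2, p a.1 a.2} : Finset V) ⊆ vs p N :=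
  subset_biUnion_of_mem (fun a : K × V => ({a.2, p a.1 a.2} : Finset V)) h

lemma Rb_union {p : K → V → V} {N N' : Finset (K × V)} (h : Rb p N) (h' : Rb p N')
    (hv : Disjoint (vs p N) (vs p N')) (hc : Disjoint (cols N) (cols N')) :
    Rb p (N ∪ N') ∧ (N ∪ N').card = N.card + N'.card := by
  refine ⟨⟨?_, ?_⟩, ?_⟩
  · intro a ha
    rcases mem_union.1 ha with h1 | h1
    · exact h.1 a h1
    · exact h'.1 a h1
  · intro a ha b hb hab
    rcases mem_union.1 ha with h1 | h1 <;> rcases mem_union.1 hb with h2 | h2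
    · exact h.2 a h1 b h2 hab
    · refine ⟨fun e => ?_, disjoint_of_subset_left (sub_vs p h1)
        (disjoint_of_subset_right (sub_vs p h2) hv)⟩
      exact disjoint_left.1 hc (mem_cols h1) (e ▸ mem_cols h2)
    · refine ⟨fun e => ?_, disjoint_of_subset_left (sub_vs p h1)
        (disjoint_of_subset_right (sub_vs p h2) hv.symm)⟩
      exact disjoint_left.1 hc (mem_cols h2) (e ▸ mem_cols h1)
    · exact h'.2 a h1 b h2 hab
  · apply card_union_of_disjoint
    rw [disjoint_left]
    intro a ha hb
    exact disjoint_left.1 hc (mem_cols ha) (mem_cols hb)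

lemma cols_union (N N' : Finset (K × V)) : cols (N ∪ N') = cols N ∪ cols N' := image_union _ _

lemma cols_single (c : K) (v : V) : cols {(c, v)} = {c} := by simp [cols]

lemma cols_card_le {N : Finset (K × V)} : (cols N).card ≤ N.card := card_image_le

lemma Fr_cols {mt : V → V} {p : K → V → V} {v : V} {Y : Finset V} {N : Finset (K × V)}
    (h : Fr mt p v Y N) : (cols N).card ≤ Y.card := by
  have h1 := h.2.2.2.2
  have h2 := cov_le (mt := mt) Y
  have h3 := cols_card_le (N := N)
  omega

lemma fact1 {mt : V → V} {p : K → V → V} (hm : ∀ v, mt (mt v) = v) (hN : NoAug mt p)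
    {r b : ℕ} (hbr : b ≤ r) {x : V} (hx : mt x ≠ x) (h1 : InF mt p r b x)
    (h2 : InF mt p r b (mt x)) : False := by
  obtain ⟨Y1, N1, f1, -, hY1, -⟩ := h1 ∅ ∅ (by intro v hv; simp at hv) (by simp) (by simp) (by simp)
  have hc := Fr_cols f1
  obtain ⟨Y2, N2, f2, hd, hY2, hd2⟩ := h2 (Y1 \ {x, mt x}) (cols N1)
    (Clo_sdiff hm f1.1 (Clo_pair hm x)) (by simp)
    ((card_le_card sdiff_subset).trans (by omega)) (by omega)
  have hx1 : ({x, mt x} : Finset V) ⊆ Y1 := by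
    intro v hv
    simp only [mem_insert, mem_singleton] at hv
    rcases hv with rfl | rfl
    · exact f1.2.2.1
    · exact f1.1 _ f1.2.2.1
  have hu : Y1 ∪ Y2 = (Y1 \ {x, mt x}) ∪ Y2 := by
    ext v
    simp only [mem_union, mem_sdiff, mem_insert, mem_singleton]
    have a1 : mt x ∈ Y2 := f2.2.2.1
    have a2 : x ∈ Y2 := by have := f2.1 _ a1; rwa [hm] at this
    constructor
    · rintro (h | h)
      · by_cases e : v = x ∨ v = mt x
        · rcases e with rfl | rfl <;> tauto
        · exact Or.inl ⟨h, e⟩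
      · exact Or.inr h
    · tauto
  have hcv : cov mt (Y1 ∪ Y2) + 2 = cov mt Y1 + cov mt Y2 := by
    rw [hu, cov_union hd.symm]
    have := cov_union (mt := mt) (sdiff_disjoint : Disjoint (Y1 \ {x, mt x}) {x, mt x})
    rw [sdiff_union_of_subset hx1, cov_pair hm hx] at this
    omega
  have hvd : Disjoint (vs p N1) (vs p N2) := by
    rw [disjoint_left]
    intro v hv1 hv2
    have a := f1.2.2.2.1 hv1
    have b := f2.2.2.2.1 hv2
    rw [mem_erase] at a b
    refine disjoint_left.1 hd b.2 ?_
    simp only [mem_sdiff, mem_insert, mem_singleton]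
    tauto
  obtain ⟨hR, hcard⟩ := Rb_union f1.2.1 f2.2.1 hvd hd2.symm
  have := hN (Y1 ∪ Y2) (N1 ∪ N2) (Clo_union f1.1 f2.1) hR (by
    rw [vs_union]
    exact union_subset_union (f1.2.2.2.1.trans (erase_subset _ _))
      (f2.2.2.2.1.trans (erase_subset _ _)))
  have e1 := f1.2.2.2.2
  have e2 := f2.2.2.2.2
  omega

lemma join {mt : V → V} {p : K → V → V} (hN : NoAug mt p)
    {Y1 Y2 : Finset V} {N1 N2 : Finset (K × V)} {u1 u2 : V} {c : K}
    (f1 : Fr mt p u1 Y1 N1) (f2 : Fr mt p u2 Y2 N2) (hY : Disjoint Y1 Y2)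
    (hc : Disjoint (cols N1) (cols N2)) (h1 : c ∉ cols N1) (h2 : c ∉ cols N2)
    (he : p c u1 = u2) : False := by
  have hu1 := f1.2.2.1
  have hu2 := f2.2.2.1
  have hvd : Disjoint (vs p N1) (vs p N2) :=
    disjoint_of_subset_left (f1.2.2.2.1.trans (erase_subset _ _))
      (disjoint_of_subset_right (f2.2.2.2.1.trans (erase_subset _ _)) hY)
  obtain ⟨hR, hcard⟩ := Rb_union f1.2.1 f2.2.1 hvd hc
  have hne : p c u1 ≠ u1 := by
    rw [he]; rintro rfl; exact disjoint_left.1 hY hu1 hu2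
  obtain ⟨hR2, hcard2⟩ := Rb_union hR (Rb_single p c u1 hne) (by
      rw [vs_union, vs_single, he, disjoint_left]
      intro v hv hv2
      simp only [mem_insert, mem_singleton] at hv2
      rcases mem_union.1 hv with h | h
      · have := f1.2.2.2.1 h
        rw [mem_erase] at this
        rcases hv2 with rfl | rfl
        · exact this.1 rfl
        · exact disjoint_left.1 hY this.2 hu2
      · have := f2.2.2.2.1 h
        rw [mem_erase] at this
        rcases hv2 with rfl | rfl
        · exact disjoint_left.1 hY hu1 this.2
        · exact this.1 rfl) (by
      rw [cols_union, cols_single, disjoint_singleton_right, mem_union]; tauto)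
  have := hN (Y1 ∪ Y2) _ (Clo_union f1.1 f2.1) hR2 (by
    rw [vs_union, vs_union, vs_single, he]
    apply union_subset
    · exact union_subset_union (f1.2.2.2.1.trans (erase_subset _ _))
        (f2.2.2.2.1.trans (erase_subset _ _))
    · intro v hv
      simp only [mem_insert, mem_singleton] at hv
      rcases hv with rfl | rfl
      · exact mem_union_left _ hu1
      · exact mem_union_right _ hu2)
  rw [hcard2, hcard, cov_union hY, card_singleton] at this
  have e1 := f1.2.2.2.2
  have e2 := f2.2.2.2.2
  omega

lemma attach {mt : V → V} {p : K → V → V} (hm : ∀ v, mt (mt v) = v)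
    {Y : Finset V} {N : Finset (K × V)} {v x : V} {c : K}
    (f : Fr mt p v Y N) (hx : x ∉ Y) (hmx : mt x ≠ x) (hc : c ∉ cols N) (he : p c x = v) :
    Fr mt p (mt x) (Y ∪ {x, mt x}) (N ∪ {(c, x)}) := by
  have hv := f.2.2.1
  have hx2 : mt x ∉ Y := fun h => hx (by have := f.1 _ h; rwa [hm] at this)
  have hYd : Disjoint Y {x, mt x} := by
    rw [disjoint_right]; intro w hw
    simp only [mem_insert, mem_singleton] at hw
    rcases hw with rfl | rfl <;> assumption
  have hne : p c x ≠ x := by rw [he]; rintro rfl; exact hx hv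
  have hsub := f.2.2.2.1
  obtain ⟨hR, hcard⟩ := Rb_union f.2.1 (Rb_single p c x hne) (by
      rw [vs_single, he, disjoint_left]
      intro w hw hw2
      have := hsub hw
      rw [mem_erase] at this
      simp only [mem_insert, mem_singleton] at hw2
      rcases hw2 with rfl | rfl
      · exact hx this.2
      · exact this.1 rfl) (by rwa [cols_single, disjoint_singleton_right])
  refine ⟨Clo_union f.1 (Clo_pair hm x), hR, by simp, ?_, ?_⟩
  · intro w hw
    rw [vs_union, vs_single, he, mem_union] at hw
    rw [mem_erase, mem_union]
    rcases hw with hw | hw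
    · have := hsub hw
      rw [mem_erase] at this
      refine ⟨?_, Or.inl this.2⟩
      rintro rfl; exact hx2 this.2
    · simp only [mem_insert, mem_singleton] at hw
      rcases hw with rfl | rfl
      · exact ⟨hmx.symm, by simp⟩
      · refine ⟨?_, Or.inl hv⟩
        rintro rfl; exact hx2 hv
  · rw [hcard, cov_union hYd, cov_pair hm hmx, card_singleton]
    have := f.2.2.2.2
    omega

lemma greedy [Fintype K] (p : K → V → V) (q : V → V) (μ : ℕ) : ∀ (P : Finset V) (Γ : Finset K),
    (∀ v ∈ P, q v ∈ P ∧ q v ≠ v ∧ q (q v) = v ∧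
      μ ≤ (univ.filter fun c => p c v = q v).card) →
    Γ.card + P.card ≤ μ →
    ∃ N, Rb p N ∧ vs p N = P ∧ 2 * N.card = P.card ∧ Disjoint (cols N) Γ := by
  intro P
  induction P using Finset.strongInduction with
  | H P ih =>
    intro Γ hP hμ
    rcases P.eq_empty_or_nonempty with rfl | ⟨v, hv⟩
    · refine ⟨∅, ⟨by simp, by simp⟩, by simp [vs], by simp, by simp [cols]⟩
    · obtain ⟨h1, h2, h3, h4⟩ := hP v hv
      have hpos : 0 < P.card := card_pos.2 ⟨v, hv⟩
      obtain ⟨c, hc, hcΓ⟩ : ∃ c ∈ univ.filter (fun c => p c v = q v), c ∉ Γ := by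
        by_contra hcon
        push Not at hcon
        have := card_le_card (show univ.filter (fun c => p c v = q v) ⊆ Γ from hcon)
        omega
      have hc' : p c v = q v := by simpa using hc
      have hsub : ({v, q v} : Finset V) ⊆ P := by
        intro w hw
        simp only [mem_insert, mem_singleton] at hw
        rcases hw with rfl | rfl <;> assumption
      have hcard : (P \ {v, q v}).card + 2 = P.card := by
        have := card_sdiff_add_card_eq_card hsub
        rwa [card_pair h2.symm] at this
      obtain ⟨N, hN1, hN2, hN3, hN4⟩ := ih (P \ {v, q v})
        (sdiff_ssubset hsub ⟨v, by simp⟩) (Γ ∪ {c}) (by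
          intro w hw
          rw [mem_sdiff] at hw
          obtain ⟨g1, g2, g3, g4⟩ := hP w hw.1
          refine ⟨?_, g2, g3, g4⟩
          rw [mem_sdiff]
          refine ⟨g1, fun h => hw.2 ?_⟩
          simp only [mem_insert, mem_singleton] at h ⊢
          rcases h with h | h
          · right; rw [← h, g3]
          · left; rw [← g3, h, h3]) (by
          have := card_union_le Γ {c}
          rw [card_singleton] at this
          omega)
      obtain ⟨hR, hcd⟩ := Rb_union hN1 (Rb_single p c v (by rw [hc']; exact h2)) (by
        rw [vs_single, hc', hN2]; exact sdiff_disjoint) (by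
        rw [cols_single]
        exact disjoint_of_subset_right subset_union_right hN4)
      refine ⟨_, hR, ?_, ?_, ?_⟩
      · rw [vs_union, vs_single, hc', hN2, sdiff_union_of_subset hsub]
      · rw [hcd, card_singleton]; omega
      · rw [cols_union, cols_single, disjoint_union_left]
        exact ⟨disjoint_of_subset_right subset_union_left hN4, by simpa using hcΓ⟩

lemma InF_mono {mt : V → V} {p : K → V → V} {r b r' b' : ℕ} (hr : r' ≤ r) (hb : b ≤ b') {v : V}
    (h : InF mt p r b v) : InF mt p r' b' v := by
  intro Z Γ h1 h2 h3 h4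
  obtain ⟨Y, N, f, g1, g2, g3⟩ := h Z Γ h1 h2 (h3.trans hr) (h4.trans hr)
  exact ⟨Y, N, f, g1, g2.trans hb, g3⟩

lemma InF_exposed {mt : V → V} {p : K → V → V} {r b : ℕ} (hb : 1 ≤ b) {v : V}
    (h : mt v = v) : InF mt p r b v := by
  intro Z Γ h1 h2 h3 h4
  refine ⟨{v}, ∅, ⟨?_, ⟨by simp, by simp⟩, by simp, by simp [vs], ?_⟩, by simpa using h2,
    by simpa using hb, by simp [cols]⟩
  · intro w hw
    rw [mem_singleton] at hw
    rw [hw, h]; simp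
  · have : cov mt {v} = 0 := by
      unfold cov
      rw [card_eq_zero, filter_eq_empty_iff]
      intro w hw
      rw [mem_singleton] at hw
      rw [hw]; simp [h]
    rw [this]; simp

end Aug


section Real
variable {V K : Type*} [Fintype V] [DecidableEq V] [DecidableEq K] [Fintype K]

def Chn (G : V → V → Prop) (s : V → V) (W P : Finset V) (z v : V) (q : V → V) : Prop :=
  P ⊆ W ∧ (∀ w ∈ P, s w ∈ P) ∧ z ∈ P ∧ s z = z ∧ (∀ w ∈ P, s w = w → w = z) ∧ v ∈ P ∧
    ∀ w ∈ P, w ≠ v → q w ∈ P ∧ q w ≠ v ∧ q w ≠ w ∧ G w (q w) ∧ q (q w) = w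

noncomputable def AA (mt : V → V) (p : K → V → V) (r b : ℕ) : Finset V :=
  univ.filter fun x => mt x ≠ x ∧ InF mt p r b (mt x)

noncomputable def ss (mt : V → V) (p : K → V → V) (r b : ℕ) (v : V) : V :=
  if v ∈ AA mt p r b ∨ mt v ∈ AA mt p r b then v else mt v

def GG (mt : V → V) (p : K → V → V) (μ : ℕ) (v w : V) : Prop :=
  v ≠ w ∧ (mt v = w ∨ μ ≤ (univ.filter fun c => p c v = w).card)

lemma mem_AA {mt : V → V} {p : K → V → V} {r b : ℕ} {x : V} :
    x ∈ AA mt p r b ↔ mt x ≠ x ∧ InF mt p r b (mt x) := by simp [AA]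

lemma ss_cases {mt : V → V} {p : K → V → V} {r b : ℕ} {v : V} (h : ss mt p r b v ≠ v) :
    ss mt p r b v = mt v ∧ v ∉ AA mt p r b ∧ mt v ∉ AA mt p r b := by
  unfold ss at *
  split_ifs at * with h1
  · exact absurd rfl h
  · push Not at h1; exact ⟨rfl, h1.1, h1.2⟩

lemma ss_inv {mt : V → V} {p : K → V → V} (hm : ∀ v, mt (mt v) = v) {r b : ℕ} (v : V) :
    ss mt p r b (ss mt p r b v) = v := by
  by_cases h : ss mt p r b v = v
  · rw [h, h]
  · obtain ⟨h1, h2, h3⟩ := ss_cases h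
    rw [h1]
    unfold ss
    rw [hm, if_neg (by tauto)]

lemma ss_fix {mt : V → V} {p : K → V → V} (hm : ∀ v, mt (mt v) = v) {r b : ℕ} (hb : 1 ≤ b) {v : V}
    (h : v ∉ AA mt p r b) (hs : ss mt p r b v = v) :
    InF mt p r b v ∧ (mt v = v ∨ mt v ∈ AA mt p r b) := by
  by_cases h1 : mt v ∈ AA mt p r b
  · refine ⟨?_, Or.inr h1⟩
    have := (mem_AA.1 h1).2
    rwa [hm] at this
  · have : mt v = v := by
      unfold ss at hs
      rwa [if_neg (by tauto)] at hs
    exact ⟨InF_exposed hb this, Or.inl this⟩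

lemma GG_symm {mt : V → V} {p : K → V → V} (hm : ∀ v, mt (mt v) = v)
    (hp : ∀ c v, p c (p c v) = v) {μ : ℕ} (v w : V)
    (h : GG mt p μ v w) : GG mt p μ w v := by
  refine ⟨h.1.symm, ?_⟩
  rcases h.2 with h | h
  · left; rw [← h, hm]
  · right
    convert h using 3
    constructor
    · intro h; rw [← h, hp]
    · intro h; rw [← h, hp]

/-- mates inside a chain -/
lemma chn_mate {mt : V → V} {p : K → V → V} {G : V → V → Prop} {r b : ℕ} {W P : Finset V}
    {z v : V} {q : V → V} (hm : ∀ v, mt (mt v) = v)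
    (h : Chn G (ss mt p r b) W P z v q) {w : V} (hw : w ∈ P) (hwz : w ≠ z) :
    mt w ∈ P ∧ mt w ≠ z ∧ mt w ≠ w := by
  have h1 : ss mt p r b w ≠ w := fun e => hwz (h.2.2.2.2.1 w hw e)
  have h2 := ss_cases h1
  have h3 := h.2.1 w hw
  have h4 : ss mt p r b w ≠ z := by
    intro e
    have := ss_inv (p := p) hm (r := r) (b := b) w
    rw [e, h.2.2.2.1] at this
    exact hwz this.symm
  rw [h2.1] at h1 h3 h4
  exact ⟨h3, h4, h1⟩

lemma realize {mt : V → V} {p : K → V → V} (hm : ∀ v, mt (mt v) = v)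
    {r b μ d : ℕ} (hb : 1 ≤ b)
    {P : Finset V} {z v : V} {q : V → V}
    (h : Chn (GG mt p μ) (ss mt p r b) (univ \ AA mt p r b) P z v q) (hPd : P.card ≤ d)
    {Z : Finset V} {Γ : Finset K} (hZ : Clo mt Z) (hZP : Disjoint P Z) (h1 : Z.card + d ≤ r)
    (h2 : Γ.card ≤ r) (h3 : Γ.card + b + d ≤ μ) : Free mt p v Z Γ (b + d) := by
  have hmate := fun w hw hwz => chn_mate hm h (w := w) hw hwz
  obtain ⟨hPW, hPs, hz, hsz, huz, hv, hq⟩ := h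
  have hzA : z ∉ AA mt p r b := (mem_sdiff.1 (hPW hz)).2
  obtain ⟨hzF, hzm⟩ := ss_fix hm hb hzA hsz
  have hPe : Clo mt (P.erase z) := by
    intro w hw
    rw [mem_erase] at hw ⊢
    have := hmate w hw.2 hw.1
    exact ⟨this.2.1, this.1⟩
  obtain ⟨Y0, N0, f0, g1, g2, g3⟩ := hzF (Z ∪ P.erase z) Γ (Clo_union hZ hPe) (by
    rw [mem_union]
    rintro (e | e)
    · exact disjoint_left.1 hZP hz e
    · simp at e) (by
    have := card_union_le Z (P.erase z)
    have := card_le_card (erase_subset z P)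
    omega) h2
  rw [disjoint_union_right] at g1
  set P1 := P.filter fun w => w ≠ z ∧ (w = v ∨ q w ≠ mt w) with hP1
  set P2 := P.filter fun w => w ≠ v ∧ q w ≠ mt w with hP2
  set P3 := P.filter fun w => w ≠ z ∧ w ≠ v ∧ q w ≠ mt w with hP3
  have hqz : z ≠ v → q z ≠ mt z := by
    intro hzv e
    have := hq z hz hzv
    rcases hzm with e2 | e2
    · exact this.2.2.1 (e.trans e2)
    · exact (mem_sdiff.1 (hPW this.1)).2 (e ▸ e2)
  have hP1P : P1 ⊆ P.erase z := by
    intro w hw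
    rw [hP1, mem_filter] at hw
    rw [mem_erase]; exact ⟨hw.2.1, hw.1⟩
  have hcards : P1.card = P2.card := by
    by_cases hvz : v = z
    · congr 1
      ext w
      simp only [hP1, hP2, mem_filter]
      subst hvz
      tauto
    · have e1 : P1 = insert v P3 := by
        ext w
        simp only [hP1, hP3, mem_filter, mem_insert]
        constructor
        · rintro ⟨a, b, c⟩
          by_cases e : w = v
          · exact Or.inl e
          · right; tauto
        · rintro (rfl | ⟨a, b, c, d⟩)
          · exact ⟨hv, hvz, Or.inl rfl⟩
          · exact ⟨a, b, Or.inr d⟩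
      have e2 : P2 = insert z P3 := by
        ext w
        simp only [hP2, hP3, mem_filter, mem_insert]
        constructor
        · rintro ⟨a, b, c⟩
          by_cases e : w = z
          · exact Or.inl e
          · right; tauto
        · rintro (rfl | ⟨a, b, c, d⟩)
          · exact ⟨hz, fun e => hvz e.symm, hqz (fun e => hvz e.symm)⟩
          · exact ⟨a, c, d⟩
      rw [e1, e2, card_insert_of_notMem (by simp [hP3]), card_insert_of_notMem (by simp [hP3])]
  have hP1c : Clo mt P1 := by
    intro w hw
    rw [hP1, mem_filter] at hw ⊢
    obtain ⟨a, b, c⟩ := hw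
    obtain ⟨m1, m2, m3⟩ := hmate w a b
    refine ⟨m1, m2, ?_⟩
    by_cases e : mt w = v
    · exact Or.inl e
    · right
      have := hq _ m1 e
      rw [hm]
      intro e2
      rcases c with c | c
      · exact this.2.1 (e2.trans c)
      · apply c
        rw [← e2, this.2.2.2.2]
        rw [e2]
  obtain ⟨N2, k1, k2, k3, k4⟩ := greedy p q μ P2 (Γ ∪ cols N0) (by
    intro w hw
    rw [hP2, mem_filter] at hw
    obtain ⟨a, b, c⟩ := hw
    obtain ⟨q1, q2, q3, q4, q5⟩ := hq w a b
    refine ⟨?_, q3, q5, ?_⟩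
    · rw [hP2, mem_filter]
      refine ⟨q1, q2, fun e => c ?_⟩
      rw [q5] at e
      have := congrArg mt e
      rw [hm] at this
      exact this.symm
    · rcases q4.2 with e | e
      · exact absurd e.symm c
      · exact e) (by
    have a1 := card_union_le Γ (cols N0)
    have a2 := Fr_cols f0
    have a3 : P2.card ≤ P.card := card_filter_le _ _
    omega)
  rw [disjoint_union_right] at k4
  have hvN0 : ∀ w ∈ P, w ∉ vs p N0 := by
    intro w hw hw2
    have := f0.2.2.2.1 hw2
    rw [mem_erase] at this
    exact disjoint_left.1 g1.2 this.2 (mem_erase.2 ⟨this.1, hw⟩)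
  obtain ⟨hR, hcd⟩ := Rb_union f0.2.1 k1 (by
    rw [k2, disjoint_right]
    intro w hw
    exact hvN0 w (mem_filter.1 hw).1) k4.2.symm
  have hd : Disjoint Y0 P1 := disjoint_of_subset_right hP1P g1.2
  refine ⟨Y0 ∪ P1, N0 ∪ N2, ⟨Clo_union f0.1 hP1c, hR, ?_, ?_, ?_⟩, ?_, ?_, ?_⟩
  · by_cases e : v = z
    · rw [e]; exact mem_union_left _ f0.2.2.1
    · apply mem_union_right
      rw [hP1, mem_filter]
      exact ⟨hv, e, Or.inl rfl⟩
  · rw [vs_union, k2]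
    intro w hw
    rw [mem_erase]
    rcases mem_union.1 hw with h | h
    · refine ⟨fun e => hvN0 v hv (e ▸ h), mem_union_left _ (mem_erase.1 (f0.2.2.2.1 h)).2⟩
    · rw [hP2, mem_filter] at h
      refine ⟨h.2.1, ?_⟩
      by_cases e : w = z
      · rw [e]; exact mem_union_left _ f0.2.2.1
      · apply mem_union_right
        rw [hP1, mem_filter]
        exact ⟨h.1, e, Or.inr h.2.2⟩
  · have e1 := f0.2.2.2.2
    have : cov mt P1 = P1.card := by
      unfold cov
      congr 1
      apply filter_true_of_mem
      intro w hw
      have := mem_erase.1 (hP1P hw)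
      exact (hmate w this.2 this.1).2.2
    rw [cov_union hd, this, hcd, hcards]
    omega
  · rw [disjoint_union_left]
    refine ⟨g1.1, disjoint_of_subset_left (hP1P.trans (erase_subset _ _)) hZP⟩
  · have := card_union_le Y0 P1
    have a3 : P1.card ≤ P.card := card_filter_le _ _
    omega
  · rw [cols_union, disjoint_union_left]
    exact ⟨g3, k4.1⟩

lemma noPair {mt : V → V} {p : K → V → V} (hm : ∀ v, mt (mt v) = v) (hN : NoAug mt p)
    {r b μ d : ℕ} (hb : 1 ≤ b) (hr : b + d + 1 ≤ r) (hμ : 2 * b + d + 1 ≤ μ)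
    {P : Finset V} {z v z' : V} {q : V → V}
    (h : Chn (GG mt p μ) (ss mt p r b) (univ \ AA mt p r b) P z v q) (hPd : P.card ≤ d)
    (hz' : z' ∉ AA mt p r b) (hzP : z' ∉ P) (hsz : ss mt p r b z' = z')
    (hG : GG mt p μ v z') : False := by
  have hzA : z ∉ AA mt p r b := (mem_sdiff.1 (h.1 h.2.2.1)).2
  obtain ⟨hzF, hzm⟩ := ss_fix hm hb hzA h.2.2.2.1
  obtain ⟨hzF', hzm'⟩ := ss_fix hm hb hz' hsz
  have hv : v ∈ P := h.2.2.2.2.2.1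
  have hmv : mt v ≠ z' := by
    intro e
    by_cases e2 : v = z
    · rw [← e2, e] at hzm
      rcases hzm with e3 | e3
      · exact hG.1 e3.symm
      · exact hz' e3
    · have := chn_mate hm h hv e2
      rw [e] at this
      exact hzP this.1
  have hmz : mt z ≠ z' := by
    intro e
    rcases hzm with e2 | e2
    · rw [e] at e2; exact hzP (e2 ▸ h.2.2.1)
    · exact hz' (e ▸ e2)
  have hheavy := hG.2.resolve_left hmv
  obtain ⟨Y2, N2, f2, g1, g2, -⟩ := hzF' (P ∪ {mt z}) ∅ (by
    intro w hw
    rw [mem_union, mem_singleton] at hw ⊢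
    rcases hw with hw | rfl
    · by_cases e : w = z
      · right; rw [e]
      · left; exact (chn_mate hm h hw e).1
    · left; rw [hm]; exact h.2.2.1) (by
    rw [mem_union, mem_singleton]
    rintro (e | e)
    · exact hzP e
    · exact hmz e.symm) (by
    have := card_union_le P {mt z}
    rw [card_singleton] at this
    omega) (by simp)
  have hc2 := Fr_cols f2
  obtain ⟨c, hc, hcΓ⟩ : ∃ c ∈ univ.filter (fun c => p c v = z'), c ∉ cols N2 := by
    by_contra hcon
    push Not at hcon
    have := card_le_card (show univ.filter (fun c => p c v = z') ⊆ cols N2 from hcon)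
    omega
  rw [disjoint_union_right] at g1
  have hcc := card_union_le (cols N2) {c}
  rw [card_singleton] at hcc
  obtain ⟨Y1, N1, f1, k1, k2, k3⟩ := realize hm hb h hPd (Z := Y2) (Γ := cols N2 ∪ {c}) f2.1
    g1.1.symm (by omega) (by omega) (by omega)
  rw [disjoint_union_right, disjoint_singleton_right] at k3
  exact join hN f1 f2 k1 k3.1 k3.2 hcΓ (by simpa using hc)

end Real


section Alt
variable {V : Type*} [Fintype V] [DecidableEq V]

lemma walk_back (s q : V → V) (hs : ∀ v, s (s v) = v) (hq : ∀ v, q (q v) = v) :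
    ∀ (i i' : ℕ) (z z' : V), s z = z → s z' = z' →
      (∀ j < i, s (q ((s ∘ q)^[j] z)) ≠ q ((s ∘ q)^[j] z)) →
      (∀ j < i', s (q ((s ∘ q)^[j] z')) ≠ q ((s ∘ q)^[j] z')) →
      (s ∘ q)^[i] z = (s ∘ q)^[i'] z' → i = i' ∧ z = z' := by
  intro i
  induction i with
  | zero =>
    intro i' z z' hz hz' h1 h2 h
    cases i' with
    | zero => exact ⟨rfl, h⟩
    | succ j =>
      exfalso
      rw [Function.iterate_succ_apply'] at h
      simp only [Function.iterate_zero, id, Function.comp] at h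
      apply h2 j (Nat.lt_succ_self j)
      have h3 := congrArg s h
      rw [hs, hz] at h3
      exact h.symm.trans h3
  | succ i ih =>
    intro i' z z' hz hz' h1 h2 h
    cases i' with
    | zero =>
      exfalso
      rw [Function.iterate_succ_apply'] at h
      simp only [Function.iterate_zero, id, Function.comp] at h
      apply h1 i (Nat.lt_succ_self i)
      have h3 := congrArg s h
      rw [hs, hz'] at h3
      exact h.trans h3.symm
    | succ j =>
      rw [Function.iterate_succ_apply', Function.iterate_succ_apply'] at h
      have h3 : (s ∘ q)^[i] z = (s ∘ q)^[j] z' := by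
        have := congrArg q (congrArg s h)
        simpa only [Function.comp, hs, hq] using this
      obtain ⟨a, b⟩ := ih j z z' hz hz' (fun k hk => h1 k (by omega)) (fun k hk => h2 k (by omega)) h3
      exact ⟨by omega, b⟩

lemma alt (s q : V → V) (hs : ∀ v, s (s v) = v) (hq : ∀ v, q (q v) = v) (W : Finset V)
    (hsW : ∀ v, s v ≠ v → v ∈ W) (hqW : ∀ v, q v ≠ v → v ∈ W) (L : ℕ)
    (hno : ¬ ∃ (P : Finset V) (z z' : V), P ⊆ W ∧ P.card ≤ 2 * L ∧ z ≠ z' ∧ z ∈ P ∧ z' ∈ P ∧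
      s z = z ∧ s z' = z' ∧ ∀ w ∈ P, s w ∈ P ∧ q w ∈ P ∧ q w ≠ w ∧ (s w = w → w = z ∨ w = z')) :
    L * (W.filter fun z => s z = z).card ≤ L * (W.filter fun z => q z = z).card + (spt s).card := by
  set v : V → ℕ → V := fun z i => (s ∘ q)^[i] z with hv
  have hv1 : ∀ z i, v z (i+1) = s (q (v z i)) := by
    intro z i
    simp only [hv, Function.iterate_succ_apply', Function.comp]
  set S := W.filter fun z => s z = z with hS
  set S1 := S.filter fun z => ∃ i < L, (∀ j < i, s (q (v z j)) ≠ q (v z j)) ∧ q (v z i) = v z i with hS1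
  set S2 := S.filter fun z => ∀ i < L, s (q (v z i)) ≠ q (v z i) with hS2
  have hcov : S ⊆ S1 ∪ S2 := by
    intro z hz
    have hzW := (mem_filter.1 hz).1
    have hzs := (mem_filter.1 hz).2
    rw [mem_union]
    by_contra hcon
    push Not at hcon
    obtain ⟨c1, c2⟩ := hcon
    have d1 : ¬ ∃ i < L, (∀ j < i, s (q (v z j)) ≠ q (v z j)) ∧ q (v z i) = v z i :=
      fun h => c1 (mem_filter.2 ⟨hz, h⟩)
    have d2 : ∃ i, i < L ∧ s (q (v z i)) = q (v z i) := by
      by_contra hc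
      push Not at hc
      exact c2 (mem_filter.2 ⟨hz, hc⟩)
    obtain ⟨i, ⟨hiL, hi⟩, hmin⟩ : ∃ i, (i < L ∧ s (q (v z i)) = q (v z i)) ∧
        ∀ j < i, ¬ (j < L ∧ s (q (v z j)) = q (v z j)) :=
      ⟨Nat.find d2, Nat.find_spec d2, fun j hj => Nat.find_min d2 hj⟩
    have hmin' : ∀ j < i, s (q (v z j)) ≠ q (v z j) := fun j hj e => hmin j hj ⟨by omega, e⟩
    have hqn : ∀ j ≤ i, q (v z j) ≠ v z j := by
      intro j hj e
      exact d1 ⟨j, by omega, fun k hk => hmin' k (by omega), e⟩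
    set P := (range (i+1)).image (v z) ∪ (range (i+1)).image (fun j => q (v z j)) with hP
    have hPmem : ∀ w, w ∈ P ↔ ∃ j ≤ i, w = v z j ∨ w = q (v z j) := by
      intro w
      simp only [hP, mem_union, mem_image, mem_range]
      constructor
      · rintro (⟨j, h1, h2⟩ | ⟨j, h1, h2⟩)
        · exact ⟨j, by omega, Or.inl h2.symm⟩
        · exact ⟨j, by omega, Or.inr h2.symm⟩
      · rintro ⟨j, h1, h2 | h2⟩
        · exact Or.inl ⟨j, by omega, h2.symm⟩
        · exact Or.inr ⟨j, by omega, h2.symm⟩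
    have hv0 : v z 0 = z := rfl
    have hzP : z ∈ P := (hPmem z).2 ⟨0, by omega, Or.inl hv0.symm⟩
    have hz'P : q (v z i) ∈ P := (hPmem _).2 ⟨i, le_refl _, Or.inr rfl⟩
    have hprop : ∀ w ∈ P, s w ∈ P ∧ q w ∈ P ∧ q w ≠ w ∧ (s w = w → w = z ∨ w = q (v z i)) := by
      intro w hw
      obtain ⟨j, hj, rfl | rfl⟩ := (hPmem w).1 hw
      · refine ⟨?_, (hPmem _).2 ⟨j, hj, Or.inr rfl⟩, hqn j hj, ?_⟩
        · cases j with
          | zero => rw [hv0, hzs]; exact hzP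
          | succ j => rw [hv1, hs]; exact (hPmem _).2 ⟨j, by omega, Or.inr rfl⟩
        · intro e
          cases j with
          | zero => exact Or.inl hv0
          | succ j =>
            exfalso
            rw [hv1, hs] at e
            exact hmin' j (by omega) e.symm
      · refine ⟨?_, (hPmem _).2 ⟨j, hj, Or.inl (hq _)⟩, ?_, ?_⟩
        · rcases Nat.lt_or_eq_of_le hj with h | rfl
          · rw [← hv1]; exact (hPmem _).2 ⟨j+1, by omega, Or.inl rfl⟩
          · rw [hi]; exact hw
        · rw [hq]; exact (hqn j hj).symm
        · intro e
          rcases Nat.lt_or_eq_of_le hj with h | rfl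
          · exact absurd e (hmin' j h)
          · exact Or.inr rfl
    refine hno ⟨P, z, q (v z i), ?_, ?_, ?_, hzP, hz'P, hzs, hi, hprop⟩
    · intro w hw; exact hqW w (hprop w hw).2.2.1
    · have a1 := card_union_le ((range (i+1)).image (v z)) ((range (i+1)).image (fun j => q (v z j)))
      have a2 := card_image_le (s := range (i+1)) (f := v z)
      have a3 := card_image_le (s := range (i+1)) (f := fun j => q (v z j))
      rw [card_range] at a2 a3
      rw [← hP] at a1
      omega
    · intro e
      have e1 := even_of_invol q hq P (fun w hw => ⟨(hprop w hw).2.1, (hprop w hw).2.2.1⟩)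
      have e2 := even_of_invol s hs (P.erase z) (by
        intro w hw
        rw [mem_erase] at hw ⊢
        have h1 := hprop w hw.2
        have h2 : s w ≠ w := by
          intro e3
          rcases h1.2.2.2 e3 with h | h
          · exact hw.1 h
          · exact hw.1 (h.trans e.symm)
        refine ⟨⟨?_, h1.1⟩, h2⟩
        intro e3
        apply h2
        have := congrArg s e3
        rw [hs, hzs] at this
        rw [e3, this])
      have e3 := card_erase_add_one hzP
      rw [← e3] at e1
      exact (Nat.even_add_one.1 e1) e2
  have hc1 : S1.card ≤ (W.filter fun z => q z = z).card := by
    have : ∀ z ∈ S1, ∃ i < L, (∀ j < i, s (q (v z j)) ≠ q (v z j)) ∧ q (v z i) = v z i :=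
      fun z hz => (mem_filter.1 hz).2
    choose! g hg using this
    apply card_le_card_of_injOn (fun z => v z (g z))
    · intro z hz
      obtain ⟨h1, h2, h3⟩ := hg z hz
      simp only [coe_filter, Set.mem_setOf_eq]
      refine ⟨?_, h3⟩
      have hzS := mem_filter.1 (mem_filter.1 hz).1
      cases hgz : g z with
      | zero => exact hzS.1
      | succ j =>
        apply hsW
        have := h2 j (by omega)
        rw [hv1, hs]
        exact this.symm
    · intro z hz z' hz' e
      exact (walk_back s q hs hq (g z) (g z') z z' (mem_filter.1 (mem_filter.1 hz).1).2
        (mem_filter.1 (mem_filter.1 hz').1).2 (hg z hz).2.1 (hg z' hz').2.1 e).2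
  have hc2 : S2.card * L ≤ (spt s).card := by
    rw [← card_range L, ← card_product]
    apply card_le_card_of_injOn (fun a => q (v a.1 a.2))
    · rintro ⟨z, i⟩ ha
      simp only [coe_product, Set.mem_prod, mem_coe, mem_range] at ha
      rw [mem_coe, mem_spt]
      exact (mem_filter.1 ha.1).2 i ha.2
    · rintro ⟨z, i⟩ ha ⟨z', i'⟩ ha' e
      simp only [coe_product, Set.mem_prod, mem_coe, mem_range] at ha ha'
      have e2 : v z i = v z' i' := by
        have := congrArg q e
        simpa only [hq] using this
      obtain ⟨h1, h2⟩ := walk_back s q hs hq i i' z z' (mem_filter.1 (mem_filter.1 ha.1).1).2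
        (mem_filter.1 (mem_filter.1 ha'.1).1).2
        (fun j hj => (mem_filter.1 ha.1).2 j (by omega))
        (fun j hj => (mem_filter.1 ha'.1).2 j (by omega)) e2
      rw [h1, h2]
  have hc3 := (card_le_card hcov).trans (card_union_le _ _)
  calc L * S.card ≤ L * (S1.card + S2.card) := Nat.mul_le_mul_left _ hc3
    _ = L * S1.card + S2.card * L := by ring
    _ ≤ _ := Nat.add_le_add (Nat.mul_le_mul_left _ hc1) hc2

def NoPair (G : V → V → Prop) (s : V → V) (W : Finset V) (l : ℕ) : Prop :=
  ∀ P z v q z', Chn G s W P z v q → P.card ≤ 2 * l → z' ∈ W → z' ∉ P → s z' = z' → G v z' → False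

lemma alt' (G : V → V → Prop) (s q : V → V) (hs : ∀ v, s (s v) = v) (W : Finset V)
    (hsW : ∀ v, s v ≠ v → v ∈ W) (hq : GMat G W q) (l : ℕ) (hP : NoPair G s W l) :
    l * (W.filter fun z => s z = z).card ≤ l * (W.filter fun z => q z = z).card + (spt s).card := by
  apply alt s q hs hq.1 W hsW (fun v hv => (hq.2 v hv).1)
  rintro ⟨P, z, z', hPW, hPl, hzz, hz, hz', hsz, hsz', hpr⟩
  have hqz := hpr z' hz'
  apply hP (P.erase z') z (q z') q z' _ _ (hPW hz') (by simp) hsz'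
  · have := (hq.2 (q z') (by rw [hq.1]; exact hqz.2.2.1.symm)).2
    rwa [hq.1] at this
  · refine ⟨(erase_subset _ _).trans hPW, ?_, mem_erase.2 ⟨hzz, hz⟩, hsz, ?_,
      mem_erase.2 ⟨hqz.2.2.1, hqz.2.1⟩, ?_⟩
    · intro w hw
      rw [mem_erase] at hw ⊢
      refine ⟨fun e => hw.1 ?_, (hpr w hw.2).1⟩
      have := congrArg s e
      rwa [hs, hsz'] at this
    · intro w hw e
      rw [mem_erase] at hw
      exact ((hpr w hw.2).2.2.2 e).resolve_right hw.1
    · intro w hw hwv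
      rw [mem_erase] at hw
      obtain ⟨h1, h2, h3, h4⟩ := hpr w hw.2
      refine ⟨mem_erase.2 ⟨fun e => hwv ?_, h2⟩, fun e => hw.1 ?_, h3, (hq.2 w h3).2, hq.1 w⟩
      · rw [← e, hq.1]
      · have := congrArg q e
        rwa [hq.1, hq.1] at this
  · exact (card_le_card (erase_subset _ _)).trans hPl

end Alt


section Dig
variable {I : Type*} [Fintype I] [DecidableEq I]

inductive Rch (N R0 : Finset I) (arc : I → I → Prop) (sz : I → ℕ) (S : Finset I) : ℕ → I → Prop
  | root {s : ℕ} {a : I} : a ∈ R0 → a ∉ S → Rch N R0 arc sz S s a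
  | step {s s' : ℕ} {a a' : I} : Rch N R0 arc sz S s a → a' ∈ N → a' ∉ R0 → a' ∉ S → arc a a' →
      s + sz a' ≤ s' → Rch N R0 arc sz S s' a'

lemma Rch.mono {N R0 : Finset I} {arc : I → I → Prop} {sz : I → ℕ} {S : Finset I} {s s' : ℕ} {a : I}
    (h : Rch N R0 arc sz S s a) (hs : s ≤ s') : Rch N R0 arc sz S s' a := by
  cases h with
  | root h1 h2 => exact Rch.root h1 h2
  | step h1 h2 h3 h4 h5 h6 => exact Rch.step h1 h2 h3 h4 h5 (h6.trans hs)

lemma Rch.anti {N R0 : Finset I} {arc : I → I → Prop} {sz : I → ℕ} {S S' : Finset I} {s : ℕ} {a : I}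
    (hS : S ⊆ S') (h : Rch N R0 arc sz S' s a) : Rch N R0 arc sz S s a := by
  induction h with
  | root h1 h2 => exact Rch.root h1 (fun h => h2 (hS h))
  | step h1 h2 h3 h4 h5 h6 ih => exact Rch.step ih h2 h3 (fun h => h4 (hS h)) h5 h6

lemma Rch.mem {N R0 : Finset I} {arc : I → I → Prop} {sz : I → ℕ} {S : Finset I} {s : ℕ} {a : I}
    (hR : R0 ⊆ N) (h : Rch N R0 arc sz S s a) : a ∈ N ∧ a ∉ S := by
  cases h with
  | root h1 h2 => exact ⟨hR h1, h2⟩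
  | step h1 h2 h3 h4 h5 h6 => exact ⟨h2, h4⟩

lemma digraph (N R0 : Finset I) (hR : R0 ⊆ N) (arc : I → I → Prop) (sz : I → ℕ) (l Mt : ℕ)
    (hl : 1 ≤ l) (hM : ∑ a ∈ N \ R0, sz a ≤ Mt) :
    ∃ S Dm : Finset I, Dm ⊆ N \ S ∧ l * S.card ≤ Mt ∧ R0 \ S ⊆ Dm ∧
      l * ((((N \ R0) \ S) \ Dm).filter fun a' => ∃ a ∈ Dm, arc a a').card ≤ Mt ∧
      (∀ a ∈ Dm, Rch N R0 arc sz S l a) ∧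
      ∀ S' : Finset I, ∑ a ∈ (Dm \ R0).filter (fun a => ¬ Rch N R0 arc sz (S ∪ S') l a), sz a
        ≤ l * S'.card := by
  obtain ⟨S, hS⟩ := Finite.exists_min (fun S : Finset I =>
    ∑ a ∈ (N \ R0).filter (fun a => Rch N R0 arc sz S l a), sz a + l * S.card)
  have hbd : ∃ s' < l, l * ((((N \ R0) \ S).filter fun a' => ¬ Rch N R0 arc sz S s' a').filter
      fun a' => ∃ a, Rch N R0 arc sz S s' a ∧ arc a a').card ≤ Mt := by
    by_contra hcon
    push Not at hcon
    set bd : ℕ → Finset I := fun s' => (((N \ R0) \ S).filter fun a' => ¬ Rch N R0 arc sz S s' a').filter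
      fun a' => ∃ a, Rch N R0 arc sz S s' a ∧ arc a a' with hbd
    have h1 : ∑ s' ∈ range l, (bd s').card ≤ Mt := by
      refine le_trans ?_ hM
      have : ∀ s' ∈ range l, (bd s').card = ∑ a ∈ N \ R0, if a ∈ bd s' then 1 else 0 := by
        intro s' _
        rw [← card_filter]
        congr 1
        ext a
        simp only [hbd, mem_filter, mem_sdiff]
        tauto
      rw [sum_congr rfl this, sum_comm]
      apply sum_le_sum
      intro a ha
      rw [← card_filter]
      set T := (range l).filter fun s' => a ∈ bd s' with hT
      rcases T.eq_empty_or_nonempty with e | hne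
      · rw [e]; simp
      · have hmem := T.min'_mem hne
        set t0 := T.min' hne with ht0
        have : T ⊆ Ico t0 (t0 + sz a) := by
          intro s' hs'
          rw [mem_Ico]
          refine ⟨T.min'_le _ hs', ?_⟩
          by_contra hlt
          push Not at hlt
          rw [hT, mem_filter] at hmem hs'
          simp only [hbd, mem_filter, mem_sdiff] at hmem hs'
          obtain ⟨_, ⟨⟨⟨a1, a2⟩, a3⟩, _⟩, b, hb, hab⟩ := hmem
          exact hs'.2.1.2 (Rch.step hb a1 a2 a3 hab hlt)
        have := card_le_card this
        rwa [Nat.card_Ico, Nat.add_sub_cancel_left] at this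
    have h2 : ∑ s' ∈ range l, (Mt + 1) ≤ ∑ s' ∈ range l, l * (bd s').card :=
      sum_le_sum fun s' hs' => hcon s' (mem_range.1 hs')
    rw [← mul_sum, sum_const, card_range, smul_eq_mul] at h2
    have := Nat.le_of_mul_le_mul_left h2 (by omega)
    omega
  obtain ⟨s', hs', hbd⟩ := hbd
  refine ⟨S, N.filter fun a => Rch N R0 arc sz S s' a, ?_, ?_, ?_, ?_, ?_, ?_⟩
  · intro a ha
    rw [mem_filter] at ha
    exact mem_sdiff.2 ⟨ha.1, (ha.2.mem hR).2⟩
  · have h1 := hS ∅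
    simp only [card_empty, mul_zero, add_zero] at h1
    have h2 : ∑ a ∈ (N \ R0).filter (fun a => Rch N R0 arc sz ∅ l a), sz a ≤ ∑ a ∈ N \ R0, sz a :=
      sum_le_sum_of_subset (filter_subset _ _)
    omega
  · intro a ha
    rw [mem_sdiff] at ha
    exact mem_filter.2 ⟨hR ha.1, Rch.root ha.1 ha.2⟩
  · refine le_trans (Nat.mul_le_mul_left _ (card_le_card ?_)) hbd
    intro a ha
    simp only [mem_filter, mem_sdiff] at ha ⊢
    obtain ⟨⟨⟨h1, h2⟩, h3⟩, b, h4, h5⟩ := ha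
    exact ⟨⟨⟨h1, h2⟩, fun h => h3 ⟨h1.1, h⟩⟩, b, h4.2, h5⟩
  · intro a ha
    exact (mem_filter.1 ha).2.mono hs'.le
  · intro S'
    have h1 := hS (S ∪ S')
    have h2 := Nat.mul_le_mul_left l (card_union_le S S')
    rw [mul_add] at h2
    have h3 : ∑ a ∈ (N \ R0).filter (fun a => Rch N R0 arc sz S l a), sz a =
        ∑ a ∈ ((N \ R0).filter (fun a => Rch N R0 arc sz S l a)).filter
          (fun a => Rch N R0 arc sz (S ∪ S') l a), sz a +
        ∑ a ∈ ((N \ R0).filter (fun a => Rch N R0 arc sz S l a)).filter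
          (fun a => ¬ Rch N R0 arc sz (S ∪ S') l a), sz a :=
      (sum_filter_add_sum_filter_not _ _ _).symm
    have h4 : ∑ a ∈ (N \ R0).filter (fun a => Rch N R0 arc sz (S ∪ S') l a), sz a ≤
        ∑ a ∈ ((N \ R0).filter (fun a => Rch N R0 arc sz S l a)).filter
          (fun a => Rch N R0 arc sz (S ∪ S') l a), sz a := by
      apply sum_le_sum_of_subset
      intro a ha
      simp only [mem_filter] at ha ⊢
      exact ⟨⟨ha.1, ha.2.anti subset_union_left⟩, ha.2⟩
    have h5 : ∑ a ∈ ((N.filter fun a => Rch N R0 arc sz S s' a) \ R0).filter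
        (fun a => ¬ Rch N R0 arc sz (S ∪ S') l a), sz a ≤
        ∑ a ∈ ((N \ R0).filter (fun a => Rch N R0 arc sz S l a)).filter
          (fun a => ¬ Rch N R0 arc sz (S ∪ S') l a), sz a := by
      apply sum_le_sum_of_subset
      intro a ha
      simp only [mem_filter, mem_sdiff] at ha ⊢
      obtain ⟨⟨⟨h1, h2⟩, h3⟩, h4⟩ := ha
      exact ⟨⟨⟨h1, h3⟩, h2.mono hs'.le⟩, h4⟩
    omega

end Dig


section Str
variable {V : Type*} [Fintype V] [DecidableEq V]

structure SD (G : V → V → Prop) (s : V → V) (W U : Finset V) (ρ : V → V) : Prop where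
  hs : ∀ v, s (s v) = v
  hG : ∀ v w, G v w → G w v
  hsW : ∀ v, s v ≠ v → v ∈ W
  hsG : ∀ v, s v ≠ v → G v (s v)
  hU : U ⊆ W
  hρ : ∀ v ∈ W \ U, ∀ w ∈ W \ U, v ≠ w → G v w → ρ v = ρ w
  hfc : ∀ v ∈ W \ U, ∃ q, GMat G (W \ U) q ∧ spt q = ((W \ U).filter fun w => ρ w = ρ v).erase v

def Qc (W U : Finset V) (ρ : V → V) (a : V) : Finset V := (W \ U).filter fun w => ρ w = a
def Bc (s : V → V) (W U : Finset V) (ρ : V → V) (a : V) : Finset V :=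
  (Qc W U ρ a).filter fun w => s w = w ∨ s w ∈ U
def NN (s : V → V) (W U : Finset V) (ρ : V → V) (l : ℕ) : Finset V :=
  ((W \ U).image ρ).filter fun a => (Bc s W U ρ a).card = 1 ∧ (Qc W U ρ a).card ≤ l
def RR (s : V → V) (W U : Finset V) (ρ : V → V) (l : ℕ) : Finset V :=
  (NN s W U ρ l).filter fun a => ∃ w ∈ Bc s W U ρ a, s w = w
def arcc (G : V → V → Prop) (s : V → V) (W U : Finset V) (ρ : V → V) (a a' : V) : Prop :=
  ∃ v ∈ Qc W U ρ a, ∃ w ∈ Bc s W U ρ a', s w ≠ w ∧ G v (s w)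
def rho' (s : V → V) (U : Finset V) (ρ : V → V) (w : V) : V := if w ∈ U then ρ (s w) else ρ w

lemma mem_Qc {W U : Finset V} {ρ : V → V} {a w : V} :
    w ∈ Qc W U ρ a ↔ (w ∈ W ∧ w ∉ U) ∧ ρ w = a := by simp [Qc]

lemma mem_Bc {s : V → V} {W U : Finset V} {ρ : V → V} {a w : V} :
    w ∈ Bc s W U ρ a ↔ w ∈ Qc W U ρ a ∧ (s w = w ∨ s w ∈ U) := by simp [Bc]

variable {G : V → V → Prop} {s : V → V} {W U : Finset V} {ρ : V → V}

lemma SD.nb (h : SD G s W U ρ) {a w : V} (hw : w ∈ Qc W U ρ a) (hb : w ∉ Bc s W U ρ a) :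
    s w ∈ Qc W U ρ a ∧ s w ∉ Bc s W U ρ a ∧ s w ≠ w := by
  have hb' : ¬ (s w = w ∨ s w ∈ U) := fun e => hb (mem_Bc.2 ⟨hw, e⟩)
  push Not at hb'
  have hw' := mem_Qc.1 hw
  have h1 : s w ∈ W := h.hsW _ (by rw [h.hs]; exact hb'.1.symm)
  have h2 := h.hρ w (mem_sdiff.2 hw'.1) (s w) (mem_sdiff.2 ⟨h1, hb'.2⟩) hb'.1.symm (h.hsG w hb'.1)
  refine ⟨mem_Qc.2 ⟨⟨h1, hb'.2⟩, h2.symm.trans hw'.2⟩, ?_, hb'.1⟩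
  rw [mem_Bc, h.hs]
  rintro ⟨-, e | e⟩
  · exact hb'.1 e.symm
  · exact hw'.1.2 e

lemma SD.odd_Q (h : SD G s W U ρ) {a : V} (ha : a ∈ (W \ U).image ρ) : Odd (Qc W U ρ a).card := by
  obtain ⟨v, hv, rfl⟩ := mem_image.1 ha
  obtain ⟨q, h1, h2⟩ := h.hfc v hv
  have h3 := even_spt q h1.1
  rw [h2] at h3
  have h4 : v ∈ Qc W U ρ (ρ v) := mem_Qc.2 ⟨mem_sdiff.1 hv, rfl⟩
  rw [← card_erase_add_one h4]
  exact Even.add_one h3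

lemma SD.even_QB (h : SD G s W U ρ) (a : V) :
    Even (Qc W U ρ a \ Bc s W U ρ a).card := by
  apply even_of_invol s h.hs
  intro v hv
  rw [mem_sdiff] at hv ⊢
  have := h.nb hv.1 hv.2
  exact ⟨⟨this.1, this.2.1⟩, this.2.2⟩

lemma Bc_sub (a : V) : Bc s W U ρ a ⊆ Qc W U ρ a := filter_subset _ _

lemma SD.odd_B (h : SD G s W U ρ) {a : V} (ha : a ∈ (W \ U).image ρ) :
    Odd (Bc s W U ρ a).card := by
  have h1 := h.odd_Q ha
  have h2 := h.even_QB a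
  rw [← card_sdiff_add_card_eq_card (Bc_sub (s := s) (W := W) (U := U) (ρ := ρ) a)] at h1
  rcases Nat.even_or_odd (Bc s W U ρ a).card with h3 | h3
  · exact absurd h1 (Nat.not_odd_iff_even.2 (h2.add h3))
  · exact h3

/-- factor-critical matching of a component -/
lemma SD.fc (h : SD G s W U ρ) {a v : V} (hv : v ∈ Qc W U ρ a) :
    ∃ q : V → V, ∀ w ∈ Qc W U ρ a, w ≠ v →
      q w ∈ Qc W U ρ a ∧ q w ≠ v ∧ q w ≠ w ∧ G w (q w) ∧ q (q w) = w := by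
  have hv' := mem_Qc.1 hv
  obtain ⟨q, h1, h2⟩ := h.hfc v (mem_sdiff.2 hv'.1)
  refine ⟨q, fun w hw hwv => ?_⟩
  have e : ((W \ U).filter fun w => ρ w = ρ v) = Qc W U ρ a := by rw [hv'.2]; rfl
  rw [e] at h2
  have h3 : w ∈ spt q := by rw [h2, mem_erase]; exact ⟨hwv, hw⟩
  have h4 := (mem_spt q w).1 h3
  have h5 : q w ∈ spt q := by rw [mem_spt, h1.1]; exact h4.symm
  rw [h2, mem_erase] at h5
  exact ⟨h5.2, h5.1, h4, (h1.2 w h4).2, h1.1 w⟩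

lemma SD.uniq {l : ℕ} {a w w' : V} (ha : a ∈ NN s W U ρ l)
    (hw : w ∈ Bc s W U ρ a) (hw' : w' ∈ Bc s W U ρ a) : w = w' :=
  card_le_one.1 ((mem_filter.1 ha).2.1.le) w hw w' hw'

lemma SD.chain (h : SD G s W U ρ) (l : ℕ) (S : Finset V) : ∀ (t : ℕ) (a : V),
    Rch (NN s W U ρ l) (RR s W U ρ l) (arcc G s W U ρ) (fun a => (Qc W U ρ a).card) S t a →
    ∀ v ∈ Qc W U ρ a, ∃ P z q, Chn G s W P z v q ∧ P.card ≤ l + 2 * t ∧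
      ∀ w ∈ P, Rch (NN s W U ρ l) (RR s W U ρ l) (arcc G s W U ρ)
        (fun a => (Qc W U ρ a).card) S t (rho' s U ρ w) := by
  intro t
  induction t using Nat.strong_induction_on with
  | _ t ih =>
    intro a hR v hv
    have hR' := hR
    have hrQ : ∀ w ∈ Qc W U ρ a, rho' s U ρ w = a := by
      intro w hw
      have := mem_Qc.1 hw
      unfold rho'
      rw [if_neg this.1.2, this.2]
    cases hR with
    | root h1 h2 =>
      obtain ⟨haN, z, hz, hsz⟩ := mem_filter.1 h1
      obtain ⟨q, hq⟩ := h.fc hv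
      refine ⟨Qc W U ρ a, z, q, ⟨?_, ?_, (mem_Bc.1 hz).1, hsz, ?_, hv, hq⟩, ?_, ?_⟩
      · intro w hw; exact (mem_Qc.1 hw).1.1
      · intro w hw
        by_cases hb : w ∈ Bc s W U ρ a
        · rw [SD.uniq haN hb hz, hsz]; exact (mem_Bc.1 hz).1
        · exact (h.nb hw hb).1
      · intro w hw e
        exact SD.uniq haN (mem_Bc.2 ⟨hw, Or.inl e⟩) hz
      · have := (mem_filter.1 haN).2.2
        omega
      · intro w hw
        rw [hrQ w hw]; exact hR'
    | @step s0 _ a0 _ h1 h2 h3 h4 h5 h6 =>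
      have hpos : 0 < (Qc W U ρ a).card := card_pos.2 ⟨v, hv⟩
      by_cases hlow : Rch (NN s W U ρ l) (RR s W U ρ l) (arcc G s W U ρ)
        (fun a => (Qc W U ρ a).card) S s0 a
      · obtain ⟨P, z, q, c1, c2, c3⟩ := ih s0 (by omega) a hlow v hv
        exact ⟨P, z, q, c1, by omega, fun w hw => (c3 w hw).mono (by omega)⟩
      · obtain ⟨v1, hv1, w0, hw0, hw0s, hGv⟩ := h5
        obtain ⟨P0, z, q0, c1, c2, c3⟩ := ih s0 (by omega) a0 h1 v1 hv1
        obtain ⟨qv, hqv⟩ := h.fc hv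
        have hu : s w0 ∈ U := (mem_Bc.1 hw0).2.resolve_left hw0s
        have hw0Q := (mem_Bc.1 hw0).1
        set u := s w0 with hudef
        have hsu : s u = w0 := h.hs w0
        have hru : rho' s U ρ u = a := by
          unfold rho'
          rw [if_pos hu, hsu]; exact (mem_Qc.1 hw0Q).2
        have huP : u ∉ P0 := fun e => hlow (hru ▸ c3 u e)
        have hQP : ∀ w ∈ Qc W U ρ a, w ∉ P0 := fun w hw e => hlow (hrQ w hw ▸ c3 w e)
        have huQ : u ∉ Qc W U ρ a := fun e => (mem_Qc.1 e).1.2 hu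
        obtain ⟨k1, k2, k3, k4, k5, k6, k7⟩ := c1
        set q : V → V := fun w => if w ∈ Qc W U ρ a then qv w else if w = u then v1 else
          if w = v1 then u else q0 w with hqdef
        have hmemP : ∀ w, w ∈ P0 ∪ insert u (Qc W U ρ a) ↔ w ∈ P0 ∨ w = u ∨ w ∈ Qc W U ρ a := by
          intro w; rw [mem_union, mem_insert]
        refine ⟨P0 ∪ insert u (Qc W U ρ a), z, q, ⟨?_, ?_, mem_union_left _ k3, k4, ?_, ?_, ?_⟩, ?_, ?_⟩
        · intro w hw
          rcases (hmemP w).1 hw with e | rfl | e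
          · exact k1 e
          · exact h.hU hu
          · exact (mem_Qc.1 e).1.1
        · intro w hw
          rw [hmemP]
          rcases (hmemP w).1 hw with e | e | e
          · exact Or.inl (k2 w e)
          · right; right; rw [e, hsu]; exact hw0Q
          · by_cases hb : w ∈ Bc s W U ρ a
            · right; left; rw [SD.uniq h2 hb hw0]
            · right; right; exact (h.nb e hb).1
        · intro w hw hsw
          rcases (hmemP w).1 hw with e | e | e
          · exact k5 w e hsw
          · exfalso
            rw [e, hsu] at hsw
            exact huQ (hsw ▸ hw0Q)
          · exfalso
            have := SD.uniq h2 (mem_Bc.2 ⟨e, Or.inl hsw⟩) hw0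
            rw [this] at hsw
            exact hw0s hsw
        · exact (hmemP v).2 (Or.inr (Or.inr hv))
        · intro w hw hwv
          have hv1Q : v1 ∉ Qc W U ρ a := fun e => hQP v1 e k6
          have hv1u : v1 ≠ u := fun e => huP (e ▸ k6)
          have hvP0 : v ∉ P0 := hQP v hv
          have huv : u ≠ v := fun e => huQ (e ▸ hv)
          have qu : q u = v1 := by simp [hqdef, huQ]
          have qv1 : q v1 = u := by simp [hqdef, hv1Q, hv1u]
          have qP : ∀ x ∈ P0, x ≠ v1 → q x = q0 x := by
            intro x hx hx1
            simp only [hqdef]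
            rw [if_neg (fun e => hQP x e hx), if_neg (show ¬ x = u from fun e => huP (e ▸ hx)), if_neg hx1]
          have qQ : ∀ x ∈ Qc W U ρ a, q x = qv x := by
            intro x hx
            simp only [hqdef]
            rw [if_pos hx]
          have hGu : G v1 u := hGv
          rcases (hmemP w).1 hw with e | rfl | e
          · by_cases ew : w = v1
            · rw [ew, qv1, qu]
              exact ⟨(hmemP _).2 (Or.inr (Or.inl rfl)), huv, hv1u.symm, hGu, rfl⟩
            · obtain ⟨m1, m2, m3, m4, m5⟩ := k7 w e ew
              rw [qP w e ew, qP _ m1 m2]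
              exact ⟨(hmemP _).2 (Or.inl m1), fun e2 => hvP0 (e2 ▸ m1), m3, m4, m5⟩
          · rw [qu, qv1]
            exact ⟨(hmemP _).2 (Or.inl k6), fun e => hvP0 (e ▸ k6), hv1u, h.hG _ _ hGu, rfl⟩
          · obtain ⟨m1, m2, m3, m4, m5⟩ := hqv w e hwv
            rw [qQ w e, qQ _ m1]
            exact ⟨(hmemP _).2 (Or.inr (Or.inr m1)), m2, m3, m4, m5⟩
        · have a1 := card_union_le P0 (insert u (Qc W U ρ a))
          have a2 := card_insert_le u (Qc W U ρ a)
          omega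
        · intro w hw
          rcases (hmemP w).1 hw with e | e | e
          · exact (c3 w e).mono (by omega)
          · rw [e, hru]; exact hR'
          · rw [hrQ w e]; exact hR'

lemma SD.count1 (h : SD G s W U ρ) {l : ℕ} (hP : NoPair G s W l) {q : V → V} (hq : GMat G W q)
    (hTB : W.card + U.card ≤ (spt q).card + ((W \ U).image ρ).card) :
    l * (∑ a ∈ (W \ U).image ρ, (Bc s W U ρ a).card) + l * (U.filter fun u => s u ∈ U).card ≤
      l * ((W \ U).image ρ).card + (spt s).card := by
  have h1 := alt' G s q h.hs W h.hsW hq l hP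
  have e1 : (W.filter fun z => q z = z).card + (spt q).card = W.card := by
    rw [← card_filter_add_card_filter_not (s := W) (fun z => q z = z)]
    congr 2
    ext v
    simp only [mem_spt, mem_filter]
    exact ⟨fun e => ⟨(hq.2 v e).1, e⟩, fun e => e.2⟩
  have e2 : ∑ a ∈ (W \ U).image ρ, (Bc s W U ρ a).card =
      ((W \ U).filter fun w => s w = w ∨ s w ∈ U).card := by
    rw [card_eq_sum_card_fiberwise (f := ρ) (t := (W \ U).image ρ)]
    · apply sum_congr rfl
      intro a _
      congr 1
      ext w
      simp only [mem_Bc, mem_Qc, mem_filter, mem_sdiff]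
      tauto
    · intro w hw
      exact mem_coe.2 (mem_image_of_mem _ (mem_filter.1 hw).1)
  have e3 : ((W \ U).filter fun w => s w = w ∨ s w ∈ U).card ≤
      (W.filter fun z => s z = z).card + (U.filter fun u => ¬ s u ∈ U).card := by
    have : ((W \ U).filter fun w => s w = w ∨ s w ∈ U) ⊆
        (W.filter fun z => s z = z) ∪ (U.filter fun u => ¬ s u ∈ U).image s := by
      intro w hw
      simp only [mem_filter, mem_sdiff] at hw
      simp only [mem_union, mem_filter, mem_image]
      rcases hw.2 with e | e
      · exact Or.inl ⟨hw.1.1, e⟩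
      · exact Or.inr ⟨s w, ⟨e, by rw [h.hs]; exact hw.1.2⟩, h.hs w⟩
    exact (card_le_card this).trans ((card_union_le _ _).trans
      (Nat.add_le_add_left card_image_le _))
  have e4 := card_filter_add_card_filter_not (s := U) (fun u => s u ∈ U)
  rw [e2, ← mul_add]
  have e5 : ((W \ U).filter fun w => s w = w ∨ s w ∈ U).card + (U.filter fun u => s u ∈ U).card ≤
    (W.filter fun z => s z = z).card + U.card := by omega
  have e6 : (W.filter fun z => q z = z).card + U.card ≤ ((W \ U).image ρ).card := by omega
  have e7 := Nat.mul_le_mul_left l e5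
  have e8 := Nat.mul_le_mul_left l e6
  rw [mul_add] at e7 e8
  rw [mul_add] at *
  omega

end Str


section Str2
variable {V : Type*} [Fintype V] [DecidableEq V]

lemma sum_fib_le (Y T : Finset V) (ρ : V → V) :
    ∑ a ∈ T, (Y.filter fun w => ρ w = a).card ≤ Y.card := by
  have h1 : ∑ a ∈ T, (Y.filter fun w => ρ w = a).card = (Y.filter fun w => ρ w ∈ T).card := by
    rw [card_eq_sum_card_fiberwise (f := ρ) (t := T)]
    · apply sum_congr rfl
      intro a ha
      congr 1
      ext w
      simp only [mem_filter]
      constructor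
      · rintro ⟨h1, rfl⟩; exact ⟨⟨h1, ha⟩, rfl⟩
      · rintro ⟨⟨h1, -⟩, h2⟩; exact ⟨h1, h2⟩
    · intro w hw
      exact mem_coe.2 (mem_filter.1 hw).2
  rw [h1]; exact card_filter_le _ _

variable {G : V → V → Prop} {s : V → V} {W U : Finset V} {ρ : V → V}

lemma SD.sumQ (h : SD G s W U ρ) (l : ℕ) :
    ∑ a ∈ NN s W U ρ l \ RR s W U ρ l, (Qc W U ρ a).card ≤ (spt s).card := by
  refine le_trans (sum_le_sum fun a ha => ?_) (sum_fib_le (spt s) (NN s W U ρ l \ RR s W U ρ l) ρ)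
  apply card_le_card
  intro w hw
  rw [mem_sdiff] at ha
  rw [mem_filter, mem_spt]
  refine ⟨fun e => ha.2 ?_, (mem_Qc.1 hw).2⟩
  exact mem_filter.2 ⟨ha.1, w, mem_Bc.2 ⟨hw, Or.inl e⟩, e⟩

lemma SD.trash (h : SD G s W U ρ) {l : ℕ} (hP : NoPair G s W l) {q : V → V} (hq : GMat G W q)
    (hTB : W.card + U.card ≤ (spt q).card + ((W \ U).image ρ).card) (S bd : Finset V)
    (hS : l * S.card ≤ (spt s).card) (hbd : l * bd.card ≤ (spt s).card) (TrL TrP TrU : Finset V)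
    (hTrL : TrL = ((W \ U).image ρ).filter fun a => a ∉ NN s W U ρ l ∨ a ∈ S ∨ a ∈ bd)
    (hTrP : TrP = TrL.biUnion (Bc s W U ρ))
    (hTrU : TrU = U.filter fun u => s u ∈ U ∨ s u ∈ TrP) :
    l * (TrU.card + TrP.card) ≤ 11 * (spt s).card := by
  have h1 := h.count1 hP hq hTB
  set Lb := (W \ U).image ρ with hLb
  set x := ∑ a ∈ Lb, ((Bc s W U ρ a).card - 1) with hx
  have hB1 : ∀ a ∈ Lb, 1 ≤ (Bc s W U ρ a).card := fun a ha => (h.odd_B ha).pos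
  have h2 : ∑ a ∈ Lb, (Bc s W U ρ a).card = x + Lb.card := by
    rw [card_eq_sum_ones, hx, ← sum_add_distrib]
    apply sum_congr rfl
    intro a ha
    have := hB1 a ha
    omega
  have h3 : l * x + l * (U.filter fun u => s u ∈ U).card ≤ (spt s).card := by
    rw [h2, mul_add] at h1
    omega
  set big := Lb.filter fun a => (Bc s W U ρ a).card = 1 ∧ l < (Qc W U ρ a).card with hbig
  have h4 : l * big.card ≤ (spt s).card := by
    refine le_trans ?_ (sum_fib_le (spt s) big ρ)
    rw [mul_comm, ← smul_eq_mul, ← sum_const]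
    apply sum_le_sum
    intro a ha
    have ha' := (mem_filter.1 ha).2
    have e1 := card_sdiff_add_card_eq_card (Bc_sub (s := s) (W := W) (U := U) (ρ := ρ) a)
    have e2 : (Qc W U ρ a \ Bc s W U ρ a).card ≤ ((spt s).filter fun w => ρ w = a).card := by
      apply card_le_card
      intro w hw
      rw [mem_sdiff] at hw
      rw [mem_filter, mem_spt]
      exact ⟨(h.nb hw.1 hw.2).2.2, (mem_Qc.1 hw.1).2⟩
    omega
  have h5 : TrP.card ≤ 2 * x + big.card + S.card + bd.card := by
    rw [hTrP]
    refine card_biUnion_le.trans ?_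
    rw [hTrL, sum_filter]
    calc ∑ a ∈ Lb, (if a ∉ NN s W U ρ l ∨ a ∈ S ∨ a ∈ bd then (Bc s W U ρ a).card else 0)
        ≤ ∑ a ∈ Lb, (2 * ((Bc s W U ρ a).card - 1) +
          (if (Bc s W U ρ a).card = 1 ∧ l < (Qc W U ρ a).card then 1 else 0) +
          (if a ∈ S then 1 else 0) + (if a ∈ bd then 1 else 0)) := by
          apply sum_le_sum
          intro a ha
          have hb := hB1 a ha
          split_ifs with c1 c2 c3 c4 c5 c6 c7 <;> try omega
          have hn : a ∉ NN s W U ρ l := by tauto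
          by_cases e1 : (Bc s W U ρ a).card = 1
          · exfalso
            apply hn
            exact mem_filter.2 ⟨ha, e1, by by_contra e2; exact c2 ⟨e1, by omega⟩⟩
          · omega
      _ = 2 * x + big.card + (Lb.filter fun a => a ∈ S).card + (Lb.filter fun a => a ∈ bd).card := by
          rw [sum_add_distrib, sum_add_distrib, sum_add_distrib, ← mul_sum, hbig, card_filter,
            card_filter, card_filter]
      _ ≤ _ := by
          have e1 : (Lb.filter fun a => a ∈ S).card ≤ S.card :=
            card_le_card fun a ha => (mem_filter.1 ha).2
          have e2 : (Lb.filter fun a => a ∈ bd).card ≤ bd.card :=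
            card_le_card fun a ha => (mem_filter.1 ha).2
          omega
  have h6 : TrU.card ≤ (U.filter fun u => s u ∈ U).card + TrP.card := by
    have : TrU ⊆ (U.filter fun u => s u ∈ U) ∪ TrP.image s := by
      intro u hu
      rw [hTrU, mem_filter] at hu
      rw [mem_union, mem_filter, mem_image]
      rcases hu.2 with e | e
      · exact Or.inl ⟨hu.1, e⟩
      · exact Or.inr ⟨s u, e, h.hs u⟩
    exact (card_le_card this).trans ((card_union_le _ _).trans (Nat.add_le_add_left card_image_le _))
  have h7 := Nat.mul_le_mul_left l h5
  have h8 := Nat.mul_le_mul_left l h6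
  have e : l * (2 * x + big.card + S.card + bd.card) =
    2 * (l * x) + l * big.card + l * S.card + l * bd.card := by ring
  rw [e] at h7
  rw [mul_add] at h8 ⊢
  omega

end Str2


section Str3
variable {V : Type*} [Fintype V] [DecidableEq V]
variable {G : V → V → Prop} {s : V → V} {W U : Finset V} {ρ : V → V}

lemma SD.geo (h : SD G s W U ρ) {l : ℕ} {S Dm bd TrL TrP TrU D U1 X : Finset V}
    (hDm : Dm ⊆ NN s W U ρ l \ S) (hR : RR s W U ρ l \ S ⊆ Dm)
    (hbd : bd = (((NN s W U ρ l \ RR s W U ρ l) \ S) \ Dm).filter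
      fun a' => ∃ a ∈ Dm, arcc G s W U ρ a a')
    (hTrL : TrL = ((W \ U).image ρ).filter fun a => a ∉ NN s W U ρ l ∨ a ∈ S ∨ a ∈ bd)
    (hTrP : TrP = TrL.biUnion (Bc s W U ρ))
    (hTrU : TrU = U.filter fun u => s u ∈ U ∨ s u ∈ TrP)
    (hD : D = (W \ U).filter fun w => ρ w ∈ Dm) (hU1 : U1 = U.filter fun u => s u ∈ D)
    (hX : X = W \ (U1 ∪ TrU ∪ TrP)) :
    D ⊆ X ∧ (∀ x ∈ X, s x = x → x ∈ D) ∧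
      (∀ v ∈ D, ∀ w ∈ X, v ≠ w → G v w → w ∈ D ∧ ρ w = ρ v) ∧
      2 * U1.card + (X \ D).card + (D.filter fun w => ¬ (s w = w ∨ s w ∈ U)).card
        ≤ (spt s).card := by
  have memD : ∀ w, w ∈ D ↔ (w ∈ W ∧ w ∉ U) ∧ ρ w ∈ Dm := by
    intro w; rw [hD, mem_filter, mem_sdiff]
  have memTP : ∀ w, w ∈ TrP ↔ ρ w ∈ TrL ∧ w ∈ Bc s W U ρ (ρ w) := by
    intro w
    rw [hTrP, mem_biUnion]
    constructor
    · rintro ⟨a, h1, h2⟩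
      have := (mem_Qc.1 (mem_Bc.1 h2).1).2
      subst this
      exact ⟨h1, h2⟩
    · rintro ⟨h1, h2⟩; exact ⟨_, h1, h2⟩
  have hDmT : ∀ a ∈ Dm, a ∉ TrL := by
    intro a ha e
    rw [hTrL, mem_filter] at e
    have h1 := mem_sdiff.1 (hDm ha)
    rcases e.2 with e | e | e
    · exact e h1.1
    · exact h1.2 e
    · rw [hbd, mem_filter, mem_sdiff] at e
      exact e.1.2 ha
  -- a port whose label is not trash
  have good : ∀ w ∈ W, w ∉ U → (s w = w ∨ s w ∈ U) → w ∉ TrP →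
      ρ w ∈ NN s W U ρ l ∧ ρ w ∉ S ∧ ρ w ∉ bd := by
    intro w h1 h2 h3 h4
    have h5 : ρ w ∉ TrL := fun e => h4 ((memTP w).2 ⟨e, mem_Bc.2 ⟨mem_Qc.2 ⟨⟨h1, h2⟩, rfl⟩, h3⟩⟩)
    have h6 : ρ w ∈ (W \ U).image ρ := mem_image_of_mem _ (mem_sdiff.2 ⟨h1, h2⟩)
    rw [hTrL, mem_filter] at h5
    by_contra hcon
    apply h5
    refine ⟨h6, ?_⟩
    tauto
  have memX : ∀ w, w ∈ X ↔ w ∈ W ∧ w ∉ U1 ∧ w ∉ TrU ∧ w ∉ TrP := by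
    intro w; rw [hX, mem_sdiff, mem_union, mem_union]; tauto
  have h1 : D ⊆ X := by
    intro w hw
    have := (memD w).1 hw
    rw [memX]
    refine ⟨this.1.1, ?_, ?_, ?_⟩
    · rw [hU1, mem_filter]; tauto
    · rw [hTrU, mem_filter]; tauto
    · rw [memTP]; exact fun e => hDmT _ this.2 e.1
  have h2 : ∀ x ∈ X, s x = x → x ∈ D := by
    intro x hx e
    rw [memX] at hx
    obtain ⟨a1, a2, a3, a4⟩ := hx
    have a5 : x ∉ U := by
      intro e2
      apply a3
      rw [hTrU, mem_filter, e]
      exact ⟨e2, Or.inl e2⟩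
    obtain ⟨g1, g2, g3⟩ := good x a1 a5 (Or.inl e) a4
    rw [memD]
    refine ⟨⟨a1, a5⟩, hR (mem_sdiff.2 ⟨mem_filter.2 ⟨g1, x, ?_, e⟩, g2⟩)⟩
    exact mem_Bc.2 ⟨mem_Qc.2 ⟨⟨a1, a5⟩, rfl⟩, Or.inl e⟩
  refine ⟨h1, h2, ?_, ?_⟩
  · intro v hv w hw hvw hGvw
    have hv' := (memD v).1 hv
    rw [memX] at hw
    obtain ⟨a1, a2, a3, a4⟩ := hw
    by_cases hwU : w ∈ U
    · exfalso
      rw [hU1, mem_filter] at a2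
      rw [hTrU, mem_filter] at a3
      have b1 : s w ∉ U := fun e => a3 ⟨hwU, Or.inl e⟩
      have b2 : s w ∉ TrP := fun e => a3 ⟨hwU, Or.inr e⟩
      have b3 : s w ∉ D := fun e => a2 ⟨hwU, e⟩
      have b4 : s w ≠ w := fun e => b1 (e.symm ▸ hwU)
      have b5 : s w ∈ W := h.hsW _ (by rw [h.hs]; exact b4.symm)
      have b6 : s (s w) ∈ U := by rw [h.hs]; exact hwU
      obtain ⟨g1, g2, g3⟩ := good (s w) b5 b1 (Or.inr b6) b2
      have b7 : ρ (s w) ∉ Dm := fun e => b3 ((memD _).2 ⟨⟨b5, b1⟩, e⟩)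
      have b8 : ρ (s w) ∉ RR s W U ρ l := fun e => b7 (hR (mem_sdiff.2 ⟨e, g2⟩))
      apply g3
      rw [hbd, mem_filter]
      refine ⟨mem_sdiff.2 ⟨mem_sdiff.2 ⟨mem_sdiff.2 ⟨g1, b8⟩, g2⟩, b7⟩, ρ v, hv'.2, v,
        mem_Qc.2 ⟨hv'.1, rfl⟩, s w, mem_Bc.2 ⟨mem_Qc.2 ⟨⟨b5, b1⟩, rfl⟩, Or.inr b6⟩, ?_, ?_⟩
      · rw [h.hs]; exact b4.symm
      · rw [h.hs]; exact hGvw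
    · have e := h.hρ v (mem_sdiff.2 hv'.1) w (mem_sdiff.2 ⟨a1, hwU⟩) hvw hGvw
      exact ⟨(memD w).2 ⟨⟨a1, hwU⟩, e ▸ hv'.2⟩, e.symm⟩
  · set DB := D.filter fun w => ¬ (s w = w ∨ s w ∈ U) with hDB
    have c1 : (U1.image s).card = U1.card := card_image_of_injective _ (fun a b e => by
      have := congrArg s e; rwa [h.hs, h.hs] at this)
    have mU1 : ∀ u ∈ U1, u ∈ U ∧ s u ∈ D := fun u hu => by rw [hU1, mem_filter] at hu; exact hu
    have mI : ∀ w ∈ U1.image s, w ∈ D ∧ s w ∈ U := by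
      intro w hw
      obtain ⟨u, hu, rfl⟩ := mem_image.1 hw
      rw [h.hs]; exact ⟨(mU1 u hu).2, (mU1 u hu).1⟩
    have d1 : Disjoint U1 (U1.image s) := by
      rw [disjoint_left]
      intro w hw hw2
      exact ((memD w).1 (mI w hw2).1).1.2 (mU1 w hw).1
    have d2 : Disjoint (U1 ∪ U1.image s) (X \ D) := by
      rw [disjoint_left]
      intro w hw hw2
      rw [mem_sdiff, memX] at hw2
      rcases mem_union.1 hw with e | e
      · exact hw2.1.2.1 e
      · exact hw2.2 (mI w e).1
    have d3 : Disjoint (U1 ∪ U1.image s ∪ (X \ D)) DB := by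
      rw [disjoint_left]
      intro w hw hw2
      rw [hDB, mem_filter] at hw2
      rcases mem_union.1 hw with e | e
      · rcases mem_union.1 e with e | e
        · exact ((memD w).1 hw2.1).1.2 (mU1 w e).1
        · exact hw2.2 (Or.inr (mI w e).2)
      · exact (mem_sdiff.1 e).2 hw2.1
    have c2 : (U1 ∪ U1.image s ∪ (X \ D) ∪ DB).card =
        2 * U1.card + (X \ D).card + DB.card := by
      rw [card_union_of_disjoint d3, card_union_of_disjoint d2, card_union_of_disjoint d1, c1]
      ring
    rw [← c2]
    apply card_le_card
    intro w hw
    rw [mem_spt]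
    intro e
    rcases mem_union.1 hw with hw | hw
    · rcases mem_union.1 hw with hw | hw
      · rcases mem_union.1 hw with hw | hw
        · have := mU1 w hw
          rw [e] at this
          exact ((memD w).1 this.2).1.2 this.1
        · have := mI w hw
          rw [e] at this
          exact ((memD w).1 this.1).1.2 this.2
      · have := mem_sdiff.1 hw
        exact this.2 (h2 w this.1 e)
    · rw [hDB, mem_filter] at hw
      exact hw.2 (Or.inl e)

lemma SD.pccount (h : SD G s W U ρ) {l : ℕ} {Dm TrP TrU D U1 X : Finset V}
    (hDm : Dm ⊆ NN s W U ρ l)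
    (hD : D = (W \ U).filter fun w => ρ w ∈ Dm)
    (hX : X = W \ (U1 ∪ TrU ∪ TrP))
    (h3 : ∀ v ∈ D, ∀ w ∈ X, v ≠ w → G v w → w ∈ D ∧ ρ w = ρ v)
    (h4 : 2 * U1.card + (X \ D).card + (D.filter fun w => ¬ (s w = w ∨ s w ∈ U)).card
        ≤ (spt s).card) (pc : V → V) (hpc : ∀ v, pc (pc v) = v) :
    (spt pc).card ≤ 2 * (univ \ W).card + (spt s).card + 2 * (TrU.card + TrP.card) +
      (X.filter fun w => pc w ∈ D ∧ pc w ≠ w ∧ ¬ G w (pc w)).card := by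
  set DB := D.filter fun w => ¬ (s w = w ∨ s w ∈ U) with hDB
  have hinj : Function.Injective pc := fun a b e => by
    have := congrArg pc e; rwa [hpc, hpc] at this
  set Bd := (univ \ W) ∪ (U1 ∪ TrU ∪ TrP) with hBd
  set E := X.filter fun w => pc w ∈ D ∧ pc w ≠ w ∧ ¬ G w (pc w) with hE
  set SC := D.filter fun v => pc v ≠ v ∧ pc v ∈ D ∧ ρ (pc v) = ρ v with hSC
  have hXB : ∀ w, w ∈ Bd ∨ w ∈ X := by
    intro w
    rw [hBd, hX, mem_union, mem_sdiff, mem_sdiff]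
    have := mem_univ w
    tauto
  have hcov : spt pc ⊆ Bd ∪ Bd.image pc ∪ (X \ D) ∪ SC ∪ E.image pc := by
    intro v hv
    rw [mem_spt] at hv
    simp only [mem_union]
    rcases hXB v with e | e
    · tauto
    rcases hXB (pc v) with e2 | e2
    · left; left; left; right
      exact mem_image.2 ⟨pc v, e2, hpc v⟩
    by_cases e3 : v ∈ D
    · by_cases e4 : pc v ∈ D ∧ ρ (pc v) = ρ v
      · left; right
        exact mem_filter.2 ⟨e3, hv, e4.1, e4.2⟩
      · right
        refine mem_image.2 ⟨pc v, mem_filter.2 ⟨e2, ?_, ?_, ?_⟩, hpc v⟩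
        · rw [hpc]; exact e3
        · rw [hpc]; exact hv.symm
        · rw [hpc]
          intro hg
          exact e4 (h3 v e3 (pc v) e2 hv.symm (h.hG _ _ hg))
    · left; left; right
      exact mem_sdiff.2 ⟨e, e3⟩
  have hSCc : SC.card ≤ DB.card := by
    have e1 : SC.card = ∑ a ∈ Dm, (SC.filter fun w => ρ w = a).card := by
      apply card_eq_sum_card_fiberwise
      intro w hw
      have := (mem_filter.1 hw).1
      rw [hD, mem_filter] at this
      exact mem_coe.2 this.2
    rw [e1]
    refine le_trans (sum_le_sum fun a ha => ?_) (sum_fib_le DB Dm ρ)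
    have haN := mem_filter.1 (hDm ha)
    have o1 := h.odd_Q haN.1
    have e2 : Even (SC.filter fun w => ρ w = a).card := by
      apply even_of_invol pc hpc
      intro v hv
      simp only [hSC, mem_filter] at hv ⊢
      obtain ⟨⟨a1, a2, a3, a4⟩, a5⟩ := hv
      rw [hpc]
      exact ⟨⟨⟨a3, a2.symm, a1, a4.symm⟩, a4.trans a5⟩, a2⟩
    have e3 : (SC.filter fun w => ρ w = a).card ≤ (Qc W U ρ a).card := by
      apply card_le_card
      intro w hw
      simp only [hSC, mem_filter] at hw
      have := hw.1.1
      rw [hD, mem_filter, mem_sdiff] at this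
      exact mem_Qc.2 ⟨this.1, hw.2⟩
    have e4 : (Qc W U ρ a \ Bc s W U ρ a).card ≤ (DB.filter fun w => ρ w = a).card := by
      apply card_le_card
      intro w hw
      rw [mem_sdiff, mem_Bc] at hw
      have := mem_Qc.1 hw.1
      rw [mem_filter, hDB, mem_filter, hD, mem_filter, mem_sdiff]
      refine ⟨⟨⟨this.1, this.2.symm ▸ ha⟩, fun e => hw.2 ⟨hw.1, e⟩⟩, this.2⟩
    have e5 := card_sdiff_add_card_eq_card (Bc_sub (s := s) (W := W) (U := U) (ρ := ρ) a)
    have e6 := haN.2.1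
    have e7 : (SC.filter fun w => ρ w = a).card ≠ (Qc W U ρ a).card := by
      intro e; rw [e] at e2; exact (Nat.not_even_iff_odd.2 o1) e2
    omega
  have hc := card_le_card hcov
  have k1 := card_union_le (Bd ∪ Bd.image pc ∪ (X \ D) ∪ SC) (E.image pc)
  have k2 := card_union_le (Bd ∪ Bd.image pc ∪ (X \ D)) SC
  have k3 := card_union_le (Bd ∪ Bd.image pc) (X \ D)
  have k4 := card_union_le Bd (Bd.image pc)
  have k5 : (Bd.image pc).card ≤ Bd.card := card_image_le
  have k6 : (E.image pc).card ≤ E.card := card_image_le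
  have k7 : Bd.card ≤ (univ \ W).card + (U1.card + TrU.card + TrP.card) := by
    have a1 := card_union_le (univ \ W) (U1 ∪ TrU ∪ TrP)
    have a2 := card_union_le (U1 ∪ TrU) TrP
    have a3 := card_union_le U1 TrU
    rw [← hBd] at a1
    omega
  omega

lemma SD.robust (h : SD G s W U ρ) {l : ℕ} {S Dm D : Finset V}
    (hDm : Dm ⊆ NN s W U ρ l \ S)
    (hD : D = (W \ U).filter fun w => ρ w ∈ Dm)
    (hrob : ∀ S' : Finset V, ∑ a ∈ (Dm \ RR s W U ρ l).filter (fun a => ¬ Rch (NN s W U ρ l)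
      (RR s W U ρ l) (arcc G s W U ρ) (fun a => (Qc W U ρ a).card) (S ∪ S') l a), (Qc W U ρ a).card
        ≤ l * S'.card) (Z : Finset V) :
    ∃ Lost : Finset V, Lost.card ≤ 2 * l * Z.card ∧ ∀ v ∈ D, v ∉ Lost →
      ∃ P z q, Chn G s W P z v q ∧ Disjoint P Z ∧ P.card ≤ 3 * l := by
  set S' := Z.image (rho' s U ρ) with hS'
  have hS'c : S'.card ≤ Z.card := card_image_le
  set R : V → Prop := fun a => Rch (NN s W U ρ l)
      (RR s W U ρ l) (arcc G s W U ρ) (fun a => (Qc W U ρ a).card) (S ∪ S') l a with hR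
  refine ⟨D.filter fun v => ¬ R (ρ v), ?_, ?_⟩
  · have e1 : (D.filter fun v => ¬ R (ρ v)) ⊆
        ((Dm \ RR s W U ρ l).filter fun a => ¬ R a).biUnion (Qc W U ρ) ∪
        (S' ∩ Dm).biUnion (Qc W U ρ) := by
      intro v hv
      rw [mem_filter, hD, mem_filter, mem_sdiff] at hv
      obtain ⟨⟨a1, a2⟩, a3⟩ := hv
      rw [mem_union, mem_biUnion, mem_biUnion]
      by_cases hr : ρ v ∈ RR s W U ρ l
      · right
        refine ⟨ρ v, mem_inter.2 ⟨?_, a2⟩, mem_Qc.2 ⟨a1, rfl⟩⟩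
        by_contra hc
        apply a3
        refine Rch.root hr ?_
        rw [mem_union]
        have := (mem_sdiff.1 (hDm a2)).2
        tauto
      · left
        exact ⟨ρ v, mem_filter.2 ⟨mem_sdiff.2 ⟨a2, hr⟩, a3⟩, mem_Qc.2 ⟨a1, rfl⟩⟩
    have e2 := (card_le_card e1).trans (card_union_le _ _)
    have e3 : (((Dm \ RR s W U ρ l).filter fun a => ¬ R a).biUnion (Qc W U ρ)).card ≤ l * S'.card :=
      card_biUnion_le.trans (hrob S')
    have e4 : ((S' ∩ Dm).biUnion (Qc W U ρ)).card ≤ S'.card * l := by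
      refine (card_biUnion_le_card_mul _ _ l fun a ha => ?_).trans
        (Nat.mul_le_mul_right _ (card_le_card inter_subset_left))
      exact (mem_filter.1 (mem_sdiff.1 (hDm (mem_inter.1 ha).2)).1).2.2
    have e5 := Nat.mul_le_mul_left l hS'c
    rw [mul_comm] at e4
    rw [mul_assoc]
    omega
  · intro v hv hvL
    have hRv : R (ρ v) := by
      by_contra hc; exact hvL (mem_filter.2 ⟨hv, hc⟩)
    rw [hD, mem_filter, mem_sdiff] at hv
    obtain ⟨P, z, q, c1, c2, c3⟩ := h.chain l (S ∪ S') l (ρ v) hRv v (mem_Qc.2 ⟨hv.1, rfl⟩)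
    refine ⟨P, z, q, c1, ?_, by omega⟩
    rw [disjoint_left]
    intro w hw hwZ
    have h1 := ((c3 w hw).mem (filter_subset _ _)).2
    exact h1 (mem_union_right _ (mem_image_of_mem _ hwZ))

theorem struct_main (hs : ∀ v, s (s v) = v) (hG : ∀ v w, G v w → G w v)
    (hsW : ∀ v, s v ≠ v → v ∈ W) (hsG : ∀ v, s v ≠ v → G v (s v)) {l : ℕ} (hl : 1 ≤ l)
    (hP : NoPair G s W l) :
    ∃ (D X : Finset V) (K0 : ℕ), D ⊆ X ∧ X ⊆ W ∧ (∀ x ∈ X, s x = x → x ∈ D) ∧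
      l * K0 ≤ 22 * (spt s).card ∧
      (∀ pc : V → V, (∀ v, pc (pc v) = v) →
        (spt pc).card ≤ 2 * (univ \ W).card + (spt s).card + K0 +
          (X.filter fun w => pc w ∈ D ∧ pc w ≠ w ∧ ¬ G w (pc w)).card) ∧
      ∀ Z : Finset V, ∃ Lost : Finset V, Lost.card ≤ 2 * l * Z.card ∧ ∀ v ∈ D, v ∉ Lost →
        ∃ P z q, Chn G s W P z v q ∧ Disjoint P Z ∧ P.card ≤ 3 * l := by
  obtain ⟨U, hU, ρ, h1, h2, q, hq, hTB⟩ := tutte_berge G hG W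
  have h : SD G s W U ρ := ⟨hs, hG, hsW, hsG, hU, h1, h2⟩
  obtain ⟨S, Dm, d1, d2, d3, d4, d5, d6⟩ := digraph (NN s W U ρ l) (RR s W U ρ l)
    (filter_subset _ _) (arcc G s W U ρ) (fun a => (Qc W U ρ a).card) l (spt s).card hl (h.sumQ l)
  set bd := (((NN s W U ρ l \ RR s W U ρ l) \ S) \ Dm).filter
      fun a' => ∃ a ∈ Dm, arcc G s W U ρ a a' with hbd
  set TrL := ((W \ U).image ρ).filter fun a => a ∉ NN s W U ρ l ∨ a ∈ S ∨ a ∈ bd with hTrL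
  set TrP := TrL.biUnion (Bc s W U ρ) with hTrP
  set TrU := U.filter fun u => s u ∈ U ∨ s u ∈ TrP with hTrU
  set D := (W \ U).filter fun w => ρ w ∈ Dm with hD
  set U1 := U.filter fun u => s u ∈ D with hU1
  set X := W \ (U1 ∪ TrU ∪ TrP) with hX
  obtain ⟨g1, g2, g3, g4⟩ := h.geo d1 d3 hbd hTrL hTrP hTrU hD hU1 hX
  have htr := h.trash hP hq hTB S bd d2 d4 TrL TrP TrU hTrL hTrP hTrU
  refine ⟨D, X, 2 * (TrU.card + TrP.card), g1, sdiff_subset, g2, ?_, ?_, ?_⟩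
  · rw [mul_left_comm]; omega
  · intro pc hpc
    exact h.pccount (d1.trans sdiff_subset) hD hX g3 g4 pc hpc
  · exact h.robust d1 hD d6

end Str3


section Level
variable {V K : Type*} [Fintype V] [DecidableEq V] [DecidableEq K] [Fintype K]

lemma AA_card {mt : V → V} {p : K → V → V} (hm : ∀ v, mt (mt v) = v) (hN : NoAug mt p)
    {r b : ℕ} (hbr : b ≤ r) :
    2 * (AA mt p r b).card + (spt (ss mt p r b)).card ≤ (spt mt).card := by
  have hinj : Function.Injective mt := fun a b h => by rw [← hm a, h, hm]
  have h1 : Disjoint (AA mt p r b) ((AA mt p r b).image mt) := by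
    rw [disjoint_left]
    intro x hx hx'
    obtain ⟨y, hy, rfl⟩ := mem_image.1 hx'
    obtain ⟨h2, h3⟩ := mem_AA.1 hy
    obtain ⟨h4, h5⟩ := mem_AA.1 hx
    rw [hm] at h5
    exact fact1 hm hN hbr h2 h5 h3
  have h2 : Disjoint (AA mt p r b ∪ (AA mt p r b).image mt) (spt (ss mt p r b)) := by
    rw [disjoint_right]
    intro x hx hx'
    obtain ⟨-, g1, g2⟩ := ss_cases ((mem_spt _ _).1 hx)
    rcases mem_union.1 hx' with h | h
    · exact g1 h
    · obtain ⟨y, hy, rfl⟩ := mem_image.1 h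
      rw [hm] at g2; exact g2 hy
  have h3 : (AA mt p r b ∪ (AA mt p r b).image mt) ∪ spt (ss mt p r b) ⊆ spt mt := by
    intro x hx
    rw [mem_spt]
    rcases mem_union.1 hx with h | h
    · rcases mem_union.1 h with h | h
      · exact (mem_AA.1 h).1
      · obtain ⟨y, hy, rfl⟩ := mem_image.1 h
        rw [hm]; exact (mem_AA.1 hy).1.symm
    · have h := (mem_spt _ _).1 h
      rw [← (ss_cases h).1]; exact h
  have h4 := card_le_card h3
  rw [card_union_of_disjoint h2, card_union_of_disjoint h1, card_image_of_injective _ hinj] at h4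
  omega

lemma promote {mt : V → V} {p : K → V → V} (hm : ∀ v, mt (mt v) = v)
    (hp : ∀ c v, p c (p c v) = v)
    {r b μ l r' b' θ : ℕ} (hb : 1 ≤ b) (h1 : r' + 3 * l + 2 ≤ r)
    (h2 : r' + 1 + b + 3 * l ≤ μ) (h3 : r' + 2 * l * (r' + 2) * μ < θ) (h4 : b + 3 * l + 2 ≤ b')
    {D : Finset V}
    (hD : ∀ Z : Finset V, ∃ Lost : Finset V, Lost.card ≤ 2 * l * Z.card ∧ ∀ v ∈ D, v ∉ Lost →
        ∃ P z q, Chn (GG mt p μ) (ss mt p r b) (univ \ AA mt p r b) P z v q ∧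
          Disjoint P Z ∧ P.card ≤ 3 * l)
    {x : V} (hx : mt x ≠ x)
    (hθ : θ ≤ (univ.filter fun c => p c x ∈ D ∧ p c x ≠ x ∧ ¬ GG mt p μ x (p c x)).card) :
    InF mt p r' b' (mt x) := by
  intro Z Γ hZ hxZ hZr hΓr
  have hZ' : Clo mt (Z ∪ {x, mt x}) := Clo_union hZ (Clo_pair hm x)
  have hZc : (Z ∪ {x, mt x}).card ≤ r' + 2 :=
    (card_union_le _ _).trans (add_le_add hZr (card_le_two))
  obtain ⟨Lost, hL, hLD⟩ := hD (Z ∪ {x, mt x})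
  set Cs := univ.filter fun c => p c x ∈ D ∧ p c x ≠ x ∧ ¬ GG mt p μ x (p c x) with hCs
  have hbad : (Γ ∪ Cs.filter fun c => p c x ∈ Lost).card < Cs.card := by
    refine lt_of_le_of_lt (card_union_le _ _) ?_
    have e1 : (Cs.filter fun c => p c x ∈ Lost).card ≤ μ * Lost.card := by
      refine card_le_mul_card_image_of_maps_to (f := fun c => p c x)
        (fun c hc => (mem_filter.1 hc).2) μ ?_
      intro v hv
      by_cases hne : ((Cs.filter fun c => p c x ∈ Lost).filter fun c => p c x = v) = ∅
      · rw [hne]; simp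
      · obtain ⟨c, hc⟩ := nonempty_iff_ne_empty.2 hne
        rw [mem_filter, mem_filter, hCs, mem_filter] at hc
        obtain ⟨⟨⟨-, -, g1, g2⟩, -⟩, rfl⟩ := hc
        have g3 : ¬ μ ≤ (univ.filter fun c' => p c' x = p c x).card := fun h =>
          g2 ⟨g1.symm, Or.inr h⟩
        refine le_trans (card_le_card ?_) (le_of_not_ge g3)
        intro c' hc'
        exact mem_filter.2 ⟨mem_univ _, (mem_filter.1 hc').2⟩
    have e2 : μ * Lost.card ≤ 2 * l * (r' + 2) * μ := by
      rw [mul_comm]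
      exact Nat.mul_le_mul_right _ (hL.trans (Nat.mul_le_mul_left _ hZc))
    omega
  obtain ⟨c, hc, hcn⟩ : ∃ c ∈ Cs, c ∉ (Γ ∪ Cs.filter fun c => p c x ∈ Lost) := by
    by_contra hcon
    push Not at hcon
    exact absurd (card_le_card hcon) (by omega)
  rw [mem_union, not_or] at hcn
  have hcL : p c x ∉ Lost := fun h => hcn.2 (mem_filter.2 ⟨hc, h⟩)
  have hc' := (mem_filter.1 hc).2
  obtain ⟨P, z, q, hch, hPZ, hPc⟩ := hLD _ hc'.1 hcL
  have hΓ1 : (insert c Γ).card ≤ r' + 1 := (card_insert_le _ _).trans (by omega)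
  obtain ⟨Y, N, f, g1, g2, g3⟩ := realize (Γ := insert c Γ) hm hb hch hPc hZ' hPZ (by omega) (by omega) (by omega)
  have hxY : x ∉ Y := fun h => (disjoint_left.1 g1 h) (by simp)
  have hcN : c ∉ cols N := fun h => (disjoint_left.1 g3 h) (by simp)
  refine ⟨_, _, attach hm f hxY hx hcN rfl, ?_, ?_, ?_⟩
  · rw [disjoint_union_left]
    refine ⟨g1.mono_right subset_union_left, ?_⟩
    rw [disjoint_left]
    intro w hw hwZ
    simp only [mem_insert, mem_singleton] at hw
    rcases hw with rfl | rfl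
    · exact hxZ (hZ _ hwZ)
    · exact hxZ hwZ
  · have := card_union_le Y {x, mt x}
    have := card_le_two (a := x) (b := mt x)
    omega
  · rw [cols_union, cols_single, disjoint_union_left]
    refine ⟨g3.mono_right (subset_insert _ _), ?_⟩
    rw [disjoint_singleton_left]; exact hcn.1

lemma exposed_edge {mt : V → V} {p : K → V → V} (hN : NoAug mt p) {c : K} {w : V}
    (h1 : mt w = w) (h2 : p c w ≠ w) : mt (p c w) ≠ p c w := by
  intro h3
  have := hN {w, p c w} {(c, w)} ?_ (Rb_single p c w h2) (by rw [vs_single])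
  · have h4 : cov mt {w, p c w} = 0 := by
      unfold cov
      rw [card_eq_zero, filter_eq_empty_iff]
      intro v hv
      simp only [mem_insert, mem_singleton] at hv
      rcases hv with rfl | rfl
      · simpa using h1
      · simpa using h3
    rw [h4] at this
    simp at this
  · intro v hv
    simp only [mem_insert, mem_singleton] at hv ⊢
    rcases hv with rfl | rfl
    · left; exact h1
    · right; exact h3

lemma level {mt : V → V} {p : K → V → V} (hm : ∀ v, mt (mt v) = v)
    (hp : ∀ c v, p c (p c v) = v) (hN : NoAug mt p)
    {r b μ l r' b' θ k : ℕ} (hk : 1 ≤ k) (hK : Fintype.card K = k) (hl : 1 ≤ l)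
    (hb : 1 ≤ b) (h1 : r' + 3 * l + 2 ≤ r)
    (h2 : r' + 1 + b + 3 * l ≤ μ) (h3 : r' + 2 * l * (r' + 2) * μ < θ) (h4 : b + 3 * l + 2 ≤ b')
    (h5 : b + 2 * l + 1 ≤ r) (h6 : 2 * b + 2 * l + 1 ≤ μ)
    (h7 : 22 * (spt mt).card ≤ l * k) (h8 : 4 * θ * (spt mt).card ≤ k * k)
    (h9 : ∀ c, (spt mt).card + 2 * k ≤ (spt (p c)).card) :
    k ≤ 4 * ((spt mt).filter fun v => InF mt p r' b' v ∧ ¬ InF mt p r b v).card := by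
  have hA := AA_card hm hN (r := r) (b := b) (by omega)
  obtain ⟨D, X, K0, hDX, hXW, hXD, hK0, hc, hrob⟩ :=
    struct_main (G := GG mt p μ) (s := ss mt p r b) (W := univ \ AA mt p r b) (l := l)
    (ss_inv hm) (GG_symm hm hp)
    (fun v hv => mem_sdiff.2 ⟨mem_univ _, (ss_cases hv).2.1⟩)
    (fun v hv => ⟨hv.symm, Or.inl (ss_cases hv).1.symm⟩) hl
    (fun P z v q z' g1 g2 g3 g4 g5 g6 =>
      noPair (d := 2 * l) hm hN hb (by omega) (by omega) g1 g2 (mem_sdiff.1 g3).2 g4 g5 g6)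
  have hWA : univ \ (univ \ AA mt p r b) = AA mt p r b := by ext; simp
  rw [hWA] at hc
  have hK0k : K0 ≤ k := by
    have : l * K0 ≤ l * k := by omega
    exact Nat.le_of_mul_le_mul_left this hl
  set H : K → Finset V := fun c => (spt mt).filter fun w => w ∈ X ∧ p c w ∈ D ∧ p c w ≠ w ∧
    ¬ GG mt p μ w (p c w) with hH
  have hHc : ∀ c, k ≤ 2 * (H c).card := by
    intro c
    have e1 := hc (p c) (hp c)
    have e2 := h9 c
    set Ec := X.filter fun w => p c w ∈ D ∧ p c w ≠ w ∧ ¬ GG mt p μ w (p c w) with hEc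
    have e3 : k ≤ Ec.card := by omega
    have e4 : Ec ⊆ H c ∪ (H c).image (p c) := by
      intro w hw
      obtain ⟨g1, g2, g3, g4⟩ := mem_filter.1 hw
      rw [mem_union]
      by_cases hw : mt w = w
      · right
        refine mem_image.2 ⟨p c w, ?_, hp c w⟩
        refine mem_filter.2 ⟨(mem_spt _ _).2 (exposed_edge hN hw g3), hDX g2, ?_, ?_, ?_⟩
        · rw [hp]; refine hXD w g1 ?_
          unfold ss; split_ifs
          · rfl
          · exact hw
        · rw [hp]; exact g3.symm
        · rw [hp]; exact fun h => g4 (GG_symm hm hp _ _ h)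
      · left
        exact mem_filter.2 ⟨(mem_spt _ _).2 hw, g1, g2, g3, g4⟩
    have e5 := (card_le_card e4).trans (card_union_le _ _)
    have e6 := card_image_le (s := H c) (f := p c)
    omega
  set Hi := (spt mt).filter fun x => x ∈ X ∧ θ ≤ (univ.filter fun c => x ∈ H c).card with hHi
  have hsum : k * k ≤ 2 * ∑ c, (H c).card := by
    rw [mul_sum]
    calc k * k = ∑ c : K, k := by simp [hK]
      _ ≤ _ := sum_le_sum fun c _ => hHc c
  have hdc : ∑ c, (H c).card = ∑ x ∈ spt mt, (univ.filter fun c => x ∈ H c).card := by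
    have := sum_card_bipartiteAbove_eq_sum_card_bipartiteBelow (s := (univ : Finset K)) (t := spt mt)
      (fun c x => x ∈ H c)
    rw [← show ∑ c, (bipartiteAbove (fun c x => x ∈ H c) (spt mt) c).card = ∑ c, (H c).card from ?_]
    · exact this
    · refine sum_congr rfl fun c _ => congrArg _ ?_
      ext x
      simp only [bipartiteAbove, mem_filter, hH]
      tauto
  have hup : ∑ x ∈ spt mt, (univ.filter fun c => x ∈ H c).card ≤ Hi.card * k + (spt mt).card * θ := by
    have : ∀ x ∈ spt mt, (univ.filter fun c => x ∈ H c).card ≤ (if x ∈ Hi then k else 0) + θ := by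
      intro x hx
      by_cases hxH : x ∈ Hi
      · rw [if_pos hxH]
        have := card_le_univ (univ.filter fun c => x ∈ H c)
        omega
      · rw [if_neg hxH]
        by_contra hcon
        apply hxH
        have hpos : 0 < (univ.filter fun c => x ∈ H c).card := by omega
        obtain ⟨c, hc⟩ := card_pos.1 hpos
        exact mem_filter.2 ⟨hx, (mem_filter.1 (mem_filter.1 hc).2).2.1, by omega⟩
    refine (sum_le_sum this).trans ?_
    rw [sum_add_distrib, sum_const, smul_eq_mul, ← sum_filter, sum_const, smul_eq_mul]
    gcongr
    intro x hx; exact (mem_filter.1 hx).2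
  have hHik : k ≤ 4 * Hi.card := by
    have : k * k ≤ (4 * Hi.card) * k := by nlinarith
    exact Nat.le_of_mul_le_mul_right this hk
  refine hHik.trans (Nat.mul_le_mul_left _ ?_)
  have hinj : Function.Injective mt := fun a b h => by rw [← hm a, h, hm]
  rw [← card_image_of_injective Hi hinj]
  apply card_le_card
  intro y hy
  obtain ⟨x, hx, rfl⟩ := mem_image.1 hy
  obtain ⟨g1, g2, g3⟩ := mem_filter.1 hx
  have g1' := (mem_spt _ _).1 g1
  refine mem_filter.2 ⟨(mem_spt _ _).2 (by rw [hm]; exact g1'.symm), ?_, ?_⟩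
  · refine promote hm hp hb h1 h2 h3 h4 hrob g1' (g3.trans (card_le_card ?_))
    intro c hc
    exact mem_filter.2 ⟨mem_univ _, (mem_filter.1 (mem_filter.1 hc).2).2.2⟩
  · intro hF
    exact (mem_sdiff.1 (hXW g2)).2 (mem_AA.2 ⟨g1', hF⟩)

theorem main_abs {mt : V → V} {p : K → V → V} (hm : ∀ v, mt (mt v) = v)
    (hp : ∀ c v, p c (p c v) = v) (hN : NoAug mt p) {m k T : ℕ} (hT : 1 ≤ T)
    (hK : Fintype.card K = k) (hmc : (spt mt).card = 2 * m) (hmT : m ≤ T * k)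
    (hkT : 10 ^ 11 * T ^ 6 ≤ k) (h9 : ∀ c, 2 * m + 2 * k ≤ (spt (p c)).card) : False := by
  have hk : 1 ≤ k := le_trans (by have := Nat.one_le_pow 6 T hT; omega) hkT
  -- parameters
  set g := 132 * T + 2 with hg
  set Λ := 8 * T + 1 with hΛ
  set bb : ℕ → ℕ := fun i => 1 + i * g with hbb
  set rr : ℕ → ℕ := fun i => 3 * Λ * g - i * g with hrr
  have hT2 : T ≤ T ^ 2 := Nat.le_self_pow (by norm_num) T
  have hT1 : 1 ≤ T ^ 2 := Nat.one_le_pow 2 T hT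
  have hΛg : Λ * g = 1056 * T ^ 2 + 148 * T + 2 := by rw [hΛ, hg]; ring
  have hstep : ∀ i, i < Λ → k ≤ 4 * ((spt mt).filter fun v =>
      InF mt p (rr (i+1)) (bb (i+1)) v ∧ ¬ InF mt p (rr i) (bb i) v).card := by
    intro i hi
    have i1 : (i + 1) * g ≤ Λ * g := Nat.mul_le_mul_right _ hi
    have i2 : (i + 1) * g = i * g + g := by ring
    have i3 : 3 * Λ * g = 3 * (Λ * g) := by ring
    have hr' : rr (i+1) ≤ 3618 * T ^ 2 := by
      simp only [hrr]; omega
    have hr'' : rr i = rr (i+1) + g := by simp only [hrr]; omega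
    have hr3 : 2 * (Λ * g) ≤ rr (i+1) := by simp only [hrr]; omega
    have hb1 : bb i + g ≤ 1 + Λ * g := by simp only [hbb]; omega
    have hb2 : bb (i+1) = bb i + g := by simp only [hbb]; omega
    have hb0 : 1 ≤ bb i := by simp only [hbb]; omega
    refine level (μ := 20000 * T ^ 2) (l := 44 * T) (θ := 10 ^ 10 * T ^ 5) hm hp hN hk hK
      (by omega) hb0 (by omega) (by omega) ?_ (by omega) (by omega) (by omega) ?_ ?_ ?_
    · calc rr (i+1) + 2 * (44 * T) * (rr (i+1) + 2) * (20000 * T ^ 2)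
          ≤ 3618 * T ^ 2 + 2 * (44 * T) * (3620 * T ^ 2) * (20000 * T ^ 2) := by
            gcongr
            omega
        _ ≤ 3618 * T ^ 5 + 2 * (44 * T) * (3620 * T ^ 2) * (20000 * T ^ 2) := by
            gcongr
            norm_num
        _ = (3618 + 6371200000) * T ^ 5 := by ring
        _ < 10 ^ 10 * T ^ 5 := by
            have : 0 < T ^ 5 := by positivity
            exact Nat.mul_lt_mul_of_pos_right (by norm_num) this
    · rw [hmc]; nlinarith
    · rw [hmc]
      calc 4 * (10 ^ 10 * T ^ 5) * (2 * m) ≤ 4 * (10 ^ 10 * T ^ 5) * (2 * (T * k)) := by gcongr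
        _ = (8 * 10 ^ 10 * T ^ 6) * k := by ring
        _ ≤ (10 ^ 11 * T ^ 6) * k := by gcongr; norm_num
        _ ≤ k * k := by gcongr
    · intro c; rw [hmc]; exact h9 c
  have hind : ∀ i, i ≤ Λ → i * k ≤ 4 * ((spt mt).filter fun v => InF mt p (rr i) (bb i) v).card := by
    intro i
    induction i with
    | zero => simp
    | succ i ih =>
      intro hi
      have e1 := ih (by omega)
      have e2 := hstep i (by omega)
      have e3 : Disjoint ((spt mt).filter fun v => InF mt p (rr i) (bb i) v)
        ((spt mt).filter fun v =>
          InF mt p (rr (i+1)) (bb (i+1)) v ∧ ¬ InF mt p (rr i) (bb i) v) := by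
        rw [disjoint_left]
        intro v hv hv'
        exact (mem_filter.1 hv').2.2 (mem_filter.1 hv).2
      have e4 : ((spt mt).filter fun v => InF mt p (rr i) (bb i) v) ∪
        ((spt mt).filter fun v =>
          InF mt p (rr (i+1)) (bb (i+1)) v ∧ ¬ InF mt p (rr i) (bb i) v) ⊆
        (spt mt).filter fun v => InF mt p (rr (i+1)) (bb (i+1)) v := by
        intro v hv
        rcases mem_union.1 hv with h | h
        · obtain ⟨a1, a2⟩ := mem_filter.1 h
          refine mem_filter.2 ⟨a1, InF_mono ?_ ?_ a2⟩
          · simp only [hrr]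
            have : (i + 1) * g = i * g + g := by ring
            omega
          · simp only [hbb]
            have : (i + 1) * g = i * g + g := by ring
            omega
        · obtain ⟨a1, a2⟩ := mem_filter.1 h
          exact mem_filter.2 ⟨a1, a2.1⟩
      have e5 := card_le_card e4
      rw [card_union_of_disjoint e3] at e5
      have : (i + 1) * k = i * k + k := by ring
      omega
  have h1 := hind Λ le_rfl
  have h2 := card_le_card (filter_subset (fun v => InF mt p (rr Λ) (bb Λ) v) (spt mt))
  rw [hmc] at h2
  have h3 : Λ * k = 8 * (T * k) + k := by rw [hΛ]; ring
  omega

end Level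


section Final

lemma matching_invol {V E : Type*} [Fintype V] [DecidableEq V] (e₁ e₂ : E → V) (M : Finset E)
    (h : IsMatchingE e₁ e₂ M) : ∃ p : V → V, (∀ v, p (p v) = v) ∧
      (∀ v, p v ≠ v → ∃ e ∈ M, edgeEnds e₁ e₂ e = {v, p v}) ∧
      (∀ e ∈ M, p (e₁ e) = e₂ e ∧ p (e₂ e) = e₁ e) ∧ (spt p).card = 2 * M.card := by
  obtain ⟨hl, hd⟩ := h
  have hu : ∀ e ∈ M, ∀ f ∈ M, ∀ v, v ∈ edgeEnds e₁ e₂ e → v ∈ edgeEnds e₁ e₂ f → e = f := by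
    intro e he f hf v h1 h2
    by_contra hne
    exact disjoint_left.1 (hd e he f hf hne) h1 h2
  have key : ∀ v : V, ∃ w : V, (∃ e ∈ M, (e₁ e = v ∧ e₂ e = w) ∨ (e₂ e = v ∧ e₁ e = w)) ∨
      (w = v ∧ ∀ e ∈ M, v ∉ edgeEnds e₁ e₂ e) := by
    intro v
    by_cases h : ∃ e ∈ M, v ∈ edgeEnds e₁ e₂ e
    · obtain ⟨e, he, hv⟩ := h
      simp only [edgeEnds, mem_insert, mem_singleton] at hv
      rcases hv with rfl | rfl
      · exact ⟨_, Or.inl ⟨e, he, Or.inl ⟨rfl, rfl⟩⟩⟩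
      · exact ⟨_, Or.inl ⟨e, he, Or.inr ⟨rfl, rfl⟩⟩⟩
    · push Not at h
      exact ⟨v, Or.inr ⟨rfl, h⟩⟩
  choose p hp using key
  have m1 : ∀ e, e₁ e ∈ edgeEnds e₁ e₂ e := fun e => by simp [edgeEnds]
  have m2 : ∀ e, e₂ e ∈ edgeEnds e₁ e₂ e := fun e => by simp [edgeEnds]
  have hE : ∀ e ∈ M, p (e₁ e) = e₂ e ∧ p (e₂ e) = e₁ e := by
    intro e he
    constructor
    · rcases hp (e₁ e) with ⟨f, hf, ⟨h1, h2⟩ | ⟨h1, h2⟩⟩ | ⟨h1, h2⟩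
      · have := hu e he f hf (e₁ e) (m1 e) (h1 ▸ m1 f)
        subst this; exact h2.symm
      · have := hu e he f hf (e₁ e) (m1 e) (h1 ▸ m2 f)
        subst this; exact absurd h1.symm (hl e he)
      · exact absurd (m1 e) (h2 e he)
    · rcases hp (e₂ e) with ⟨f, hf, ⟨h1, h2⟩ | ⟨h1, h2⟩⟩ | ⟨h1, h2⟩
      · have := hu e he f hf (e₂ e) (m2 e) (h1 ▸ m1 f)
        subst this; exact absurd h1 (hl e he)
      · have := hu e he f hf (e₂ e) (m2 e) (h1 ▸ m2 f)
        subst this; exact h2.symm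
      · exact absurd (m2 e) (h2 e he)
  refine ⟨p, ?_, ?_, hE, ?_⟩
  · intro v
    rcases hp v with ⟨f, hf, ⟨h1, h2⟩ | ⟨h1, h2⟩⟩ | ⟨h1, h2⟩
    · rw [← h2, ← h1]; exact (hE f hf).2
    · rw [← h2, ← h1]; exact (hE f hf).1
    · rw [h1, h1]
  · intro v hv
    rcases hp v with ⟨f, hf, ⟨h1, h2⟩ | ⟨h1, h2⟩⟩ | ⟨h1, h2⟩
    · exact ⟨f, hf, by rw [← h2, ← h1]; rfl⟩
    · exact ⟨f, hf, by rw [← h2, ← h1, pair_comm]; rfl⟩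
    · exact absurd h1 hv
  · have : spt p = M.biUnion (edgeEnds e₁ e₂) := by
      ext v
      rw [mem_spt, mem_biUnion]
      constructor
      · intro hv
        by_contra hc
        push Not at hc
        rcases hp v with ⟨f, hf, ⟨h1, h2⟩ | ⟨h1, h2⟩⟩ | ⟨h1, h2⟩
        · exact hc f hf (h1 ▸ m1 f)
        · exact hc f hf (h1 ▸ m2 f)
        · exact hv h1
      · rintro ⟨e, he, hv⟩
        simp only [edgeEnds, mem_insert, mem_singleton] at hv
        rcases hv with rfl | rfl
        · rw [(hE e he).1]; exact (hl e he).symm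
        · rw [(hE e he).2]; exact hl e he
    rw [this, card_biUnion (fun a ha b hb hab => hd a ha b hb hab)]
    rw [sum_congr rfl (g := fun _ => 2)
      (fun e he => show (edgeEnds e₁ e₂ e).card = 2 from card_pair (hl e he))]
    simp [mul_comm]

lemma noAug_of_max {n : ℕ} {V E : Type} [Fintype V] [DecidableEq V] [Fintype E]
    (e₁ e₂ : E → V) (col : E → Fin n) (M : Finset E) (hM : IsMatchingE e₁ e₂ M)
    (hR : IsRainbow col M)
    (hmax : ∀ M', IsMatchingE e₁ e₂ M' → IsRainbow col M' → M'.card ≤ M.card)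
    (mt : V → V) (hmt : ∀ e ∈ M, mt (e₁ e) = e₂ e ∧ mt (e₂ e) = e₁ e)
    (p : {c : Fin n // c ∉ M.image col} → V → V)
    (hp : ∀ c v, p c v ≠ v → ∃ e, col e = c ∧ e₁ e ≠ e₂ e ∧ edgeEnds e₁ e₂ e = {v, p c v}) :
    NoAug mt p := by
  intro Y N hY hN hYN
  have hch : ∀ a : {c : Fin n // c ∉ M.image col} × V, a ∈ N → ∃ e, col e = a.1 ∧ e₁ e ≠ e₂ e ∧
      edgeEnds e₁ e₂ e = {a.2, p a.1 a.2} := fun a ha => hp a.1 a.2 (hN.1 a ha)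
  by_cases hNe : N = ∅
  · simp [hNe]
  obtain ⟨a0, ha0⟩ := nonempty_iff_ne_empty.2 hNe
  obtain ⟨e0, -⟩ := hch a0 ha0
  choose f hf using fun a => (show ∃ e, a ∈ N → col e = a.1 ∧ e₁ e ≠ e₂ e ∧
      edgeEnds e₁ e₂ e = {a.2, p a.1 a.2} from by
        by_cases ha : a ∈ N
        · obtain ⟨e, he⟩ := hch a ha
          exact ⟨e, fun _ => he⟩
        · exact ⟨e0, fun h => absurd h ha⟩)
  have hcolK : ∀ e ∈ M, ∀ a ∈ N, col e ≠ col (f a) := by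
    intro e he a ha h
    rw [(hf a ha).1] at h
    exact a.1.2 (mem_image.2 ⟨e, he, h⟩)
  have hfinj : ∀ a ∈ N, ∀ b ∈ N, col (f a) = col (f b) → a = b := by
    intro a ha b hb h
    by_contra hne
    rw [(hf a ha).1, (hf b hb).1] at h
    exact (hN.2 a ha b hb hne).1 (Subtype.ext h)
  have hcross : ∀ e ∈ M, e₁ e ∉ Y → ∀ a ∈ N, Disjoint (edgeEnds e₁ e₂ e) (edgeEnds e₁ e₂ (f a)) := by
    intro e he heY a ha
    rw [(hf a ha).2.2]
    refine disjoint_of_subset_right ((sub_vs p ha).trans hYN) ?_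
    rw [disjoint_left]
    intro v hv hvY
    simp only [edgeEnds, mem_insert, mem_singleton] at hv
    rcases hv with rfl | rfl
    · exact heY hvY
    · exact heY ((hmt e he).2 ▸ hY _ hvY)
  set M1 := M.filter fun e => e₁ e ∉ Y with hM1
  have hM'1 : IsMatchingE e₁ e₂ (M1 ∪ N.image f) := by
    constructor
    · intro e he
      rcases mem_union.1 he with h | h
      · exact hM.1 e (mem_filter.1 h).1
      · obtain ⟨a, ha, rfl⟩ := mem_image.1 h
        exact (hf a ha).2.1
    · intro e he e' he' hne
      rcases mem_union.1 he with h | h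
      · obtain ⟨g1, g2⟩ := mem_filter.1 h
        rcases mem_union.1 he' with h' | h'
        · exact hM.2 e g1 e' (mem_filter.1 h').1 hne
        · obtain ⟨a, ha, rfl⟩ := mem_image.1 h'
          exact hcross e g1 g2 a ha
      · obtain ⟨a, ha, rfl⟩ := mem_image.1 h
        rcases mem_union.1 he' with h' | h'
        · obtain ⟨g1, g2⟩ := mem_filter.1 h'
          exact (hcross e' g1 g2 a ha).symm
        · obtain ⟨b, hb, rfl⟩ := mem_image.1 h'
          rw [(hf a ha).2.2, (hf b hb).2.2]
          exact (hN.2 a ha b hb (fun hab => hne (by rw [hab]))).2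
  have hM'2 : IsRainbow col (M1 ∪ N.image f) := by
    intro e he e' he' hc
    rw [mem_coe] at he he'
    rcases mem_union.1 he with h | h
    · obtain ⟨g1, g2⟩ := mem_filter.1 h
      rcases mem_union.1 he' with h' | h'
      · exact hR (mem_coe.2 g1) (mem_coe.2 (mem_filter.1 h').1) hc
      · obtain ⟨a, ha, rfl⟩ := mem_image.1 h'
        exact absurd hc (hcolK e g1 a ha)
    · obtain ⟨a, ha, rfl⟩ := mem_image.1 h
      rcases mem_union.1 he' with h' | h'
      · exact absurd hc.symm (hcolK e' (mem_filter.1 h').1 a ha)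
      · obtain ⟨b, hb, rfl⟩ := mem_image.1 h'
        rw [hfinj a ha b hb hc]
  have hcard := hmax _ hM'1 hM'2
  have hdis : Disjoint M1 (N.image f) := by
    rw [disjoint_left]
    intro e he he'
    obtain ⟨a, ha, rfl⟩ := mem_image.1 he'
    exact hcolK _ (mem_filter.1 he).1 a ha rfl
  rw [card_union_of_disjoint hdis, card_image_of_injOn
    (fun a ha b hb h => hfinj a ha b hb (by rw [h]))] at hcard
  have hsplit := card_filter_add_card_filter_not (s := M) (fun e => e₁ e ∈ Y)
  have hcov : 2 * (M.filter fun e => e₁ e ∈ Y).card ≤ cov mt Y := by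
    have h1 : ((M.filter fun e => e₁ e ∈ Y).biUnion (edgeEnds e₁ e₂)) ⊆ Y.filter fun v => mt v ≠ v := by
      intro v hv
      obtain ⟨e, he, hv⟩ := mem_biUnion.1 hv
      obtain ⟨g1, g2⟩ := mem_filter.1 he
      simp only [edgeEnds, mem_insert, mem_singleton] at hv
      rcases hv with rfl | rfl
      · refine mem_filter.2 ⟨g2, ?_⟩
        rw [(hmt e g1).1]; exact (hM.1 e g1).symm
      · refine mem_filter.2 ⟨(hmt e g1).1 ▸ hY _ g2, ?_⟩
        rw [(hmt e g1).2]; exact hM.1 e g1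
    have h2 := card_le_card h1
    rw [card_biUnion (fun a ha b hb hab => hM.2 a (mem_filter.1 ha).1 b (mem_filter.1 hb).1 hab),
      sum_congr rfl (g := fun _ => 2) (fun e he =>
        show (edgeEnds e₁ e₂ e).card = 2 from card_pair (hM.1 e (mem_filter.1 he).1))] at h2
    simp only [sum_const, smul_eq_mul] at h2
    unfold cov
    omega
  have hs2 : (M.filter fun e => e₁ e ∈ Y).card + M1.card = M.card := by
    rw [← hsplit]
  omega

lemma arith {n m k : ℕ} (hn : 5000 ^ 8 ≤ n) (hk : n = m + k)
    (h : (m : ℝ) < (n : ℝ) - 20 * (n : ℝ) ^ ((7 : ℝ) / 8)) :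
    m ≤ (n / k + 1) * k ∧ 10 ^ 11 * (n / k + 1) ^ 6 ≤ k := by
  set x : ℝ := (n : ℝ) ^ ((1 : ℝ) / 8) with hx
  have hn0 : (0 : ℝ) ≤ n := Nat.cast_nonneg n
  have hx8 : x ^ 8 = n := by
    rw [hx, ← Real.rpow_natCast, ← Real.rpow_mul hn0]; norm_num
  have hx7 : x ^ 7 = (n : ℝ) ^ ((7 : ℝ) / 8) := by
    rw [hx, ← Real.rpow_natCast, ← Real.rpow_mul hn0]; norm_num
  have hx0 : 0 ≤ x := Real.rpow_nonneg hn0 _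
  have hx5 : 5000 ≤ x := by
    by_contra hc
    push Not at hc
    have h1 : x ^ 8 < 5000 ^ 8 := pow_lt_pow_left₀ hc hx0 (by norm_num)
    rw [hx8] at h1
    have h2 : ((5000 ^ 8 : ℕ) : ℝ) ≤ n := by exact_mod_cast hn
    push_cast at h2
    linarith
  rw [← hx7] at h
  have hkR : (n : ℝ) = m + k := by exact_mod_cast hk
  have hk20 : 20 * x ^ 7 < k := by linarith
  have hx7p : 0 < x ^ 7 := by positivity
  have hkp : (0 : ℝ) < k := by linarith
  have hkp' : 0 < k := by exact_mod_cast hkp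
  constructor
  · have := Nat.lt_mul_div_succ n hkp'
    rw [mul_comm] at this
    omega
  · have h1 : ((n / k : ℕ) : ℝ) ≤ (n : ℝ) / k := Nat.cast_div_le
    have h2 : (n : ℝ) / k ≤ x / 20 := by
      rw [div_le_div_iff₀ hkp (by norm_num), ← hx8]
      nlinarith
    have h3 : ((n / k : ℕ) : ℝ) + 1 ≤ x / 10 := by linarith
    have h4 : (((n / k : ℕ) : ℝ) + 1) ^ 6 ≤ (x / 10) ^ 6 :=
      pow_le_pow_left₀ (by positivity) h3 6
    have h5 : (10 : ℝ) ^ 11 * (((n / k : ℕ) : ℝ) + 1) ^ 6 ≤ k := by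
      have e1 : (10 : ℝ) ^ 11 * (x / 10) ^ 6 = 10 ^ 5 * x ^ 6 := by ring
      have e2 : x ^ 7 = x * x ^ 6 := by ring
      have e3 : 0 ≤ x ^ 6 := by positivity
      nlinarith
    exact_mod_cast h5

end Final

/-- Theorem 8 of the paper: for all sufficiently large `n`, every
`n`-edge-coloured multigraph whose colour classes are matchings of size at least
`n` contains a rainbow matching of size at least `n - 20 n^{7/8}`. -/
theorem stmt_11 :
    ∃ n₀ : ℕ, ∀ n : ℕ, n₀ ≤ n →
      ∀ (V E : Type) [Fintype V] [DecidableEq V] [Fintype E],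
        ∀ (e₁ e₂ : E → V) (col : E → Fin n),
          (∀ c : Fin n, IsMatchingE e₁ e₂ (colourClass col c) ∧
            n ≤ (colourClass col c).card) →
          ∃ M : Finset E, IsMatchingE e₁ e₂ M ∧ IsRainbow col M ∧
            (n : ℝ) - 20 * (n : ℝ) ^ ((7 : ℝ) / 8) ≤ M.card := by
  refine ⟨5000 ^ 8, ?_⟩
  intro n hn V E _ _ _ e₁ e₂ col hcol
  obtain ⟨M, hMm, hmax'⟩ := exists_max_image
    (univ.filter fun M : Finset E => IsMatchingE e₁ e₂ M ∧ IsRainbow col M) Finset.card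
    ⟨∅, mem_filter.2 ⟨mem_univ _, by simp [IsMatchingE], by simp [IsRainbow]⟩⟩
  obtain ⟨-, hM, hR⟩ := mem_filter.1 hMm
  have hmax : ∀ M', IsMatchingE e₁ e₂ M' → IsRainbow col M' → M'.card ≤ M.card :=
    fun M' h1 h2 => hmax' M' (mem_filter.2 ⟨mem_univ _, h1, h2⟩)
  refine ⟨M, hM, hR, ?_⟩
  by_contra hlt
  push Not at hlt
  obtain ⟨mt, hm1, -, hm3, hm4⟩ := matching_invol e₁ e₂ M hM
  choose q hq1 hq2 hq3 hq4 using fun c => matching_invol e₁ e₂ (colourClass col c) (hcol c).1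
  have himg : (M.image col).card = M.card := card_image_of_injOn hR
  have hle : M.card ≤ n := by
    rw [← himg]; exact (card_le_univ _).trans (by simp)
  obtain ⟨a1, a2⟩ := arith (n := n) (m := M.card) (k := n - M.card) hn (by omega) hlt
  have hN : NoAug mt (fun (c : {c : Fin n // c ∉ M.image col}) => q c.1) := by
    refine noAug_of_max e₁ e₂ col M hM hR hmax mt hm3 _ ?_
    intro c v hv
    obtain ⟨e, he, h2⟩ := hq2 c.1 v hv
    exact ⟨e, by simpa [colourClass] using he, (hcol c.1).1.1 e he, h2⟩
  refine main_abs (k := n - M.card) hm1 (fun c v => hq1 c.1 v) hN (Nat.le_add_left 1 _) ?_ hm4 a1 a2 ?_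
  · have h := Fintype.card_subtype_compl (fun c : Fin n => c ∈ M.image col)
    rw [Fintype.card_coe, himg, Fintype.card_fin] at h
    convert h using 1
  · intro c
    rw [hq4 c.1]
    have := (hcol c.1).2
    omega
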